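/- Let μ be a critical aperiodic probability measure on ℤ₊ belonging to the domain of attraction of a stable law of index α ∈ (1,2], fix k ≥ 1, and for n ≥ k consider k independent Bienaymé–Galton–Watson trees T_1,…,T_k with offspring distribution μ, conditioned on |T_1| + … + |T_k| = n; let M_n^{μ,k} = max_{1≤i≤k} |T_i|. Then for every fixed m ≥ 0, ℙ(n − M_n^{μ,k} = m) converges as n → ∞ to the probability that the total size of k − 1 independent unconditioned Bienaymé–Galton–Watson trees with offspring distribution μ equals m. -/

import Mathlib

open Filter Set

noncomputable section

/-- A plane tree in Neveu's formalism: a finite set of finite words of positive integers,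
containing the root `[]`, closed under prefixes, and such that the children of a vertex `u`
are `u1, …, u k_u`. -/
structure PlaneTree where
  verts : Finset (List ℕ)
  root_mem : [] ∈ verts
  prefix_closed : ∀ u v : List ℕ, u <+: v → v ∈ verts → u ∈ verts
  labels_pos : ∀ u ∈ verts, ∀ i ∈ u, 1 ≤ i
  children_closed : ∀ (u : List ℕ) (i : ℕ), 1 ≤ i → u ++ [i + 1] ∈ verts → u ++ [i] ∈ verts

namespace PlaneTree

/-- The number of children of the vertex `u` in `τ`. -/
def kc (τ : PlaneTree) (u : List ℕ) : ℕ := Set.ncard {i : ℕ | u ++ [i] ∈ τ.verts}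

/-- The number of vertices of the subtree grafted on `u` (that is, `u` and its descendants). -/
def subtreeSize (τ : PlaneTree) (u : List ℕ) : ℕ :=
  Set.ncard {v : List ℕ | v ∈ τ.verts ∧ u <+: v}

/-- `M(τ)`: the size of the largest subtree grafted on a child of the root of `τ`. -/
def maxSub (τ : PlaneTree) : ℕ := (Finset.Icc 1 (τ.kc [])).sup fun i => τ.subtreeSize [i]

end PlaneTree

/-- The Bienaymé–Galton–Watson weight `BGW^μ(τ) = ∏_{u ∈ τ} μ(k_u)` of a plane tree. -/
def bgwW (μ : ℕ → ℝ) (τ : PlaneTree) : ℝ := ∏ u ∈ τ.verts, μ (τ.kc u)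

/-- The modified Bienaymé–Galton–Watson weight of a plane tree: the root reproduces according
to `μ0` and the other vertices according to `μ`. -/
def bgwModW (μ0 μ : ℕ → ℝ) (τ : PlaneTree) : ℝ :=
  μ0 (τ.kc []) * ∏ u ∈ τ.verts.erase [], μ (τ.kc u)

/-- The total mass `BGW^{μ0,μ}(T_n)` given by the modified Bienaymé–Galton–Watson measure to
plane trees with `n` vertices. -/
def bgwModMass (μ0 μ : ℕ → ℝ) (n : ℕ) : ℝ :=
  ∑ᶠ τ ∈ {τ : PlaneTree | τ.verts.card = n}, bgwModW μ0 μ τ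

/-- `μ` belongs to the domain of attraction of a stable law of index `α ∈ (1,2]`: either
`α = 2` and `μ` has finite variance, or `α < 2` and the tail `μ([n,∞))` equals `g(n) n^{-α}`
for a slowly varying function `g`. -/
def DomAttr (μ : ℕ → ℝ) (α : ℝ) : Prop :=
  (α = 2 ∧ Summable fun k : ℕ => (k : ℝ) ^ 2 * μ k) ∨
  (α < 2 ∧ ∃ g : ℝ → ℝ, (∀ x : ℝ, 0 < x → 0 < g x) ∧
    (∀ c : ℝ, 0 < c → Tendsto (fun x => g (c * x) / g x) atTop (nhds 1)) ∧
    ∀ n : ℕ, 1 ≤ n → (∑' k : ℕ, {m : ℕ | n ≤ m}.indicator μ k) = g n * (n : ℝ) ^ (-α))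

namespace PlaneTree

theorem ext' {a b : PlaneTree} (h : a.verts = b.verts) : a = b := by
  cases a; cases b; simp at h; subst h; rfl

/-- Graft `j` trees on a new root. -/
def graft (j : ℕ) (F : Fin j → PlaneTree) : PlaneTree where
  verts := insert [] ((Finset.univ : Finset (Fin j)).biUnion fun i =>
    (F i).verts.image (fun u => (i.1 + 1) :: u))
  root_mem := by simp
  prefix_closed := by
    intro u v huv hv
    cases u with
    | nil => simp
    | cons a u =>
      cases v with
      | nil => simp at huv
      | cons b v =>
        rw [List.cons_prefix_cons] at huv
        obtain ⟨rfl, huv⟩ := huv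
        simp only [Finset.mem_insert, reduceCtorEq, Finset.mem_biUnion, Finset.mem_univ, true_and,
          Finset.mem_image, List.cons.injEq, false_or] at hv ⊢
        obtain ⟨i, w, hw, hi, rfl⟩ := hv
        exact ⟨i, u, (F i).prefix_closed _ _ huv hw, hi, rfl⟩
  labels_pos := by
    intro u hu
    simp only [Finset.mem_insert, Finset.mem_biUnion, Finset.mem_univ, true_and,
          Finset.mem_image] at hu
    rcases hu with rfl | ⟨i, w, hw, rfl⟩
    · simp
    · intro x hx
      rw [List.mem_cons] at hx
      rcases hx with rfl | hx
      · omega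
      · exact (F i).labels_pos w hw x hx
  children_closed := by
    intro u i hi h
    cases u with
    | nil =>
      simp only [List.nil_append, Finset.mem_insert, reduceCtorEq, Finset.mem_biUnion,
        Finset.mem_univ, true_and, Finset.mem_image, List.cons.injEq, false_or] at h ⊢
      obtain ⟨a, w, hw, ha, rfl⟩ := h
      exact ⟨⟨i - 1, by omega⟩, [], (F _).root_mem, by simp; omega, rfl⟩
    | cons b u =>
      simp only [List.cons_append, Finset.mem_insert, reduceCtorEq, Finset.mem_biUnion,
        Finset.mem_univ, true_and, Finset.mem_image, List.cons.injEq, false_or] at h ⊢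
      obtain ⟨a, w, hw, ha, rfl⟩ := h
      exact ⟨a, _, (F a).children_closed _ _ hi hw, ha, rfl⟩

theorem mem_graft_cons {j : ℕ} {F : Fin j → PlaneTree} {b : ℕ} {u : List ℕ} :
    b :: u ∈ (graft j F).verts ↔ ∃ i : Fin j, i.1 + 1 = b ∧ u ∈ (F i).verts := by
  simp only [graft, Finset.mem_insert, reduceCtorEq, Finset.mem_biUnion,
        Finset.mem_univ, true_and, Finset.mem_image, List.cons.injEq, false_or]
  constructor
  · rintro ⟨i, w, hw, hi, rfl⟩; exact ⟨i, hi, hw⟩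
  · rintro ⟨i, hi, hw⟩; exact ⟨i, u, hw, hi, rfl⟩

theorem mem_graft_cons' {j : ℕ} {F : Fin j → PlaneTree} {i : Fin j} {u : List ℕ} :
    (i.1 + 1) :: u ∈ (graft j F).verts ↔ u ∈ (F i).verts := by
  rw [mem_graft_cons]
  constructor
  · rintro ⟨i', hi, hw⟩
    obtain rfl : i' = i := by ext; omega
    exact hw
  · intro h; exact ⟨i, rfl, h⟩

theorem kc_graft_nil (j : ℕ) (F : Fin j → PlaneTree) : (graft j F).kc [] = j := by
  unfold kc
  have : {i : ℕ | [] ++ [i] ∈ (graft j F).verts} = (Finset.Icc 1 j : Finset ℕ) := by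
    ext b
    simp only [List.nil_append, mem_ofPred_eq, mem_graft_cons, Finset.coe_Icc, mem_Icc]
    constructor
    · rintro ⟨i, rfl, -⟩; have := i.2; omega
    · intro hb; exact ⟨⟨b - 1, by omega⟩, by simp; omega, (F _).root_mem⟩
  rw [this, Set.ncard_coe_finset]; simp

theorem kc_graft_cons (j : ℕ) (F : Fin j → PlaneTree) (i : Fin j) (u : List ℕ) :
    (graft j F).kc ((i.1 + 1) :: u) = (F i).kc u := by
  unfold kc
  congr 1
  ext b
  simp only [List.cons_append, mem_ofPred_eq, mem_graft_cons']

theorem graft_disj (j : ℕ) (F : Fin j → PlaneTree) :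
    ((Finset.univ : Finset (Fin j)) : Set (Fin j)).PairwiseDisjoint fun i =>
    (F i).verts.image (fun u => (i.1 + 1) :: u) := by
  intro i _ i' _ hii
  simp only [Function.onFun]
  rw [Finset.disjoint_left]
  intro x hx hx'
  simp only [Finset.mem_image] at hx hx'
  obtain ⟨w, _, rfl⟩ := hx
  obtain ⟨w', _, h⟩ := hx'
  simp at h
  exact hii (by ext; omega)

theorem sum_graft {M : Type*} [CommMonoid M] (j : ℕ) (F : Fin j → PlaneTree) (f : List ℕ → M) :
    ∏ u ∈ (graft j F).verts, f u = f [] * ∏ i, ∏ u ∈ (F i).verts, f ((i.1 + 1) :: u) := by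
  unfold graft
  simp only
  rw [Finset.prod_insert, Finset.prod_biUnion (graft_disj j F)]
  · congr 1
    refine Finset.prod_congr rfl fun i _ => ?_
    rw [Finset.prod_image]
    intro a _ b _ h
    simpa using h
  · simp

theorem card_graft (j : ℕ) (F : Fin j → PlaneTree) :
    (graft j F).verts.card = 1 + ∑ i, (F i).verts.card := by
  have := sum_graft (M := Multiplicative ℕ) j F (fun _ => Multiplicative.ofAdd 1)
  simp only [Finset.prod_const, ← ofAdd_nsmul, ← ofAdd_sum, ← ofAdd_add] at this
  have := Multiplicative.ofAdd.injective this
  simpa using this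

theorem bgwW_graft (μ : ℕ → ℝ) (j : ℕ) (F : Fin j → PlaneTree) :
    bgwW μ (graft j F) = μ j * ∏ i, bgwW μ (F i) := by
  unfold bgwW
  rw [sum_graft, kc_graft_nil]
  simp only [kc_graft_cons]

theorem child_iff (τ : PlaneTree) (b : ℕ) : [b] ∈ τ.verts ↔ 1 ≤ b ∧ b ≤ τ.kc [] := by
  have hfin : {i : ℕ | [] ++ [i] ∈ τ.verts}.Finite := by
    have : {i : ℕ | [] ++ [i] ∈ τ.verts} ⊆ (fun u : List ℕ => u.headD 0) '' (τ.verts : Set (List ℕ)) := by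
      intro i hi
      exact ⟨[i], by simpa using hi, by simp⟩
    exact (τ.verts.finite_toSet.image _).subset this
  have hdown : ∀ d a : ℕ, 1 ≤ a → [a + d] ∈ τ.verts → [a] ∈ τ.verts := by
    intro d
    induction d with
    | zero => intro a _ h; simpa using h
    | succ d ih =>
      intro a ha h
      apply ih a ha
      have := τ.children_closed [] (a + d) (by omega)
      simp only [List.nil_append] at this
      exact this (by rw [add_assoc]; exact h)
  have hpos : ∀ b, [b] ∈ τ.verts → 1 ≤ b := fun b hb => τ.labels_pos [b] hb b (by simp)
  constructor
  · intro hb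
    refine ⟨hpos b hb, ?_⟩
    unfold kc
    have hs : ((Finset.Icc 1 b : Finset ℕ) : Set ℕ) ⊆ {i : ℕ | [] ++ [i] ∈ τ.verts} := by
      intro a ha
      simp only [Finset.coe_Icc, mem_Icc] at ha
      simp only [List.nil_append, mem_ofPred_eq]
      exact hdown (b - a) a ha.1 (by rw [show a + (b - a) = b by omega]; exact hb)
    have := Set.ncard_le_ncard hs hfin
    rw [Set.ncard_coe_finset] at this
    simpa using this
  · rintro ⟨h1, h2⟩
    by_contra hb
    have hs : {i : ℕ | [] ++ [i] ∈ τ.verts} ⊆ ((Finset.Ico 1 b : Finset ℕ) : Set ℕ) := by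
      intro a ha
      simp only [List.nil_append, mem_ofPred_eq] at ha
      simp only [Finset.coe_Ico, mem_Ico]
      refine ⟨hpos a ha, ?_⟩
      by_contra hab
      exact hb (hdown (a - b) b h1 (by rw [show b + (a - b) = a by omega]; exact ha))
    have := Set.ncard_le_ncard hs (Finset.finite_toSet _)
    rw [Set.ncard_coe_finset] at this
    simp at this
    unfold kc at h2
    simp at h2
    omega

/-- The subtree grafted at the `i`-th child of the root. -/
def sub (τ : PlaneTree) (i : Fin (τ.kc [])) : PlaneTree where
  verts := τ.verts.preimage (fun u => (i.1 + 1) :: u) (List.cons_injective.injOn)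
  root_mem := by
    rw [Finset.mem_preimage, child_iff]; have := i.2; omega
  prefix_closed := by
    intro u v huv hv
    rw [Finset.mem_preimage] at hv ⊢
    exact τ.prefix_closed _ _ (by rw [List.cons_prefix_cons]; exact ⟨rfl, huv⟩) hv
  labels_pos := by
    intro u hu x hx
    rw [Finset.mem_preimage] at hu
    exact τ.labels_pos _ hu x (List.mem_cons_of_mem _ hx)
  children_closed := by
    intro u a ha hu
    rw [Finset.mem_preimage] at hu ⊢
    exact τ.children_closed ((i.1 + 1) :: u) a ha hu

theorem graft_sub (τ : PlaneTree) : graft (τ.kc []) τ.sub = τ := by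
  apply ext'
  ext u
  cases u with
  | nil => simp [τ.root_mem, (graft (τ.kc []) τ.sub).root_mem]
  | cons b u =>
    rw [mem_graft_cons]
    constructor
    · rintro ⟨i, rfl, h⟩
      simpa [sub] using h
    · intro h
      have hb : [b] ∈ τ.verts := τ.prefix_closed [b] (b :: u) (by simp) h
      rw [child_iff] at hb
      refine ⟨⟨b - 1, by omega⟩, by simp; omega, ?_⟩
      have h' : (b - 1 + 1) :: u ∈ τ.verts := by rw [show b - 1 + 1 = b by omega]; exact h
      simpa [sub] using h'

theorem graft_inj {j : ℕ} : Function.Injective (graft j) := by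
  intro F F' h
  funext i
  apply ext'
  ext u
  rw [← mem_graft_cons' (F := F), h, mem_graft_cons']

theorem card_pos (τ : PlaneTree) : 1 ≤ τ.verts.card :=
  Finset.card_pos.mpr ⟨[], τ.root_mem⟩

theorem finite_le (n : ℕ) : {τ : PlaneTree | τ.verts.card ≤ n}.Finite := by
  induction n with
  | zero =>
    convert Set.finite_empty (α := PlaneTree)
    ext τ
    have := τ.card_pos
    simp only [mem_ofPred_eq, mem_empty_iff_false, iff_false]; omega
  | succ n ih =>
    have hf : (⋃ j ∈ Finset.range (n + 1), graft j '' (Set.univ.pi fun _ : Fin j =>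
        {τ : PlaneTree | τ.verts.card ≤ n})).Finite := by
      apply Set.Finite.biUnion (Finset.finite_toSet _)
      intro j _
      exact (Set.Finite.pi fun _ => ih).image _
    refine hf.subset ?_
    intro τ hτ
    simp only [mem_ofPred_eq] at hτ
    have hc := card_graft (τ.kc []) τ.sub
    rw [graft_sub] at hc
    have h1 : τ.kc [] ≤ ∑ i, (τ.sub i).verts.card := by
      calc τ.kc [] = ∑ i : Fin (τ.kc []), 1 := by simp
        _ ≤ _ := Finset.sum_le_sum fun i _ => (τ.sub i).card_pos
    rw [Set.mem_iUnion₂]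
    refine ⟨τ.kc [], by simp; omega, τ.sub, ?_, graft_sub τ⟩
    intro i _
    simp only [mem_ofPred_eq]
    have : (τ.sub i).verts.card ≤ ∑ i, (τ.sub i).verts.card :=
      Finset.single_le_sum (f := fun i => (τ.sub i).verts.card) (fun _ _ => Nat.zero_le _) (Finset.mem_univ i)
    omega

theorem finite_eq (n : ℕ) : {τ : PlaneTree | τ.verts.card = n}.Finite :=
  (finite_le n).subset fun _ h => le_of_eq h

end PlaneTree

open PlaneTree

/-- The trees with `n` vertices. -/
def treesF (n : ℕ) : Finset PlaneTree := (finite_eq n).toFinset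

theorem mem_treesF {n : ℕ} {τ : PlaneTree} : τ ∈ treesF n ↔ τ.verts.card = n := by
  simp [treesF]

/-- Probability of size `n`. -/
def tp (μ : ℕ → ℝ) (n : ℕ) : ℝ := ∑ τ ∈ treesF n, bgwW μ τ

theorem forest_finite (k : ℕ) (D : Finset (Fin k → ℕ)) :
    {F : Fin k → PlaneTree | (fun i => (F i).verts.card) ∈ D}.Finite := by
  have : {F : Fin k → PlaneTree | (fun i => (F i).verts.card) ∈ D} ⊆
      ⋃ s ∈ D, Set.univ.pi fun i => {τ : PlaneTree | τ.verts.card = s i} := by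
    intro F hF
    rw [Set.mem_iUnion₂]
    exact ⟨_, hF, fun i _ => rfl⟩
  exact (Set.Finite.biUnion (Finset.finite_toSet _) fun s _ => Set.Finite.pi fun _ => finite_eq _).subset this

theorem forest_sum (μ : ℕ → ℝ) (k : ℕ) (D : Finset (Fin k → ℕ)) :
    ∑ᶠ F ∈ {F : Fin k → PlaneTree | (fun i => (F i).verts.card) ∈ D}, ∏ i, bgwW μ (F i) =
    ∑ s ∈ D, ∏ i, tp μ (s i) := by
  classical
  rw [finsum_mem_eq_finite_toFinset_sum _ (forest_finite k D)]
  rw [← Finset.sum_fiberwise_of_maps_to (t := D) (g := fun F i => (F i).verts.card)]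
  · refine Finset.sum_congr rfl fun s hs => ?_
    simp only [tp]
    rw [Finset.prod_univ_sum]
    refine Finset.sum_congr ?_ fun _ _ => rfl
    ext F
    simp only [Finset.mem_filter, Finite.mem_toFinset, mem_ofPred_eq, Fintype.mem_piFinset, mem_treesF]
    constructor
    · rintro ⟨_, h⟩ i; exact congrFun h i
    · intro h
      have : (fun i => (F i).verts.card) = s := funext h
      exact ⟨this ▸ hs, this⟩
  · intro F hF
    simpa using hF

/-- Generating series of sizes. -/
def tP (μ : ℕ → ℝ) : PowerSeries ℝ := PowerSeries.mk (tp μ)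

theorem tP_pow_coeff (μ : ℕ → ℝ) (k n : ℕ) :
    PowerSeries.coeff n (tP μ ^ k) =
      ∑ s ∈ (Finset.univ : Finset (Fin k)).piAntidiag n, ∏ i, tp μ (s i) := by
  have := PowerSeries.coeff_prod (fun _ : Fin k => tP μ) n Finset.univ
  simp only [Finset.prod_const, Finset.card_univ, Fintype.card_fin] at this
  rw [this]
  refine Finset.sum_bij (fun l _ => (l : Fin k → ℕ)) ?_ ?_ ?_ ?_
  · intro l hl
    simpa using hl
  · intro a _ b _ h
    exact DFunLike.coe_injective h
  · intro b hb
    exact ⟨Finsupp.equivFunOnFinite.symm b, by simpa using hb, rfl⟩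
  · intro l _
    simp [tP]

theorem forest_sum_eq (μ : ℕ → ℝ) (k n : ℕ) :
    ∑ᶠ F ∈ {F : Fin k → PlaneTree | (∑ i, (F i).verts.card) = n}, ∏ i, bgwW μ (F i) =
    PowerSeries.coeff n (tP μ ^ k) := by
  rw [tP_pow_coeff, ← forest_sum]
  simp

theorem tp_zero (μ : ℕ → ℝ) : tp μ 0 = 0 := by
  unfold tp
  rw [Finset.sum_eq_zero]
  intro τ hτ
  rw [mem_treesF] at hτ
  have := τ.card_pos
  omega

theorem tp_nonneg (μ : ℕ → ℝ) (h : ∀ j, 0 ≤ μ j) (n : ℕ) : 0 ≤ tp μ n :=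
  Finset.sum_nonneg fun _ _ => Finset.prod_nonneg fun _ _ => h _

theorem tp_succ (μ : ℕ → ℝ) (n : ℕ) :
    tp μ (n + 1) = ∑ j ∈ Finset.range (n + 1), μ j * PowerSeries.coeff n (tP μ ^ j) := by
  classical
  unfold tp
  have key : ∀ j, μ j * PowerSeries.coeff n (tP μ ^ j) =
      ∑ τ ∈ (treesF (n+1)).filter (fun τ => τ.kc [] = j), bgwW μ τ := by
    intro j
    rw [← forest_sum_eq]
    have hfin : {F : Fin j → PlaneTree | (∑ i, (F i).verts.card) = n}.Finite := by
      have := forest_finite j ((Finset.univ : Finset (Fin j)).piAntidiag n)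
      simpa using this
    rw [finsum_mem_eq_finite_toFinset_sum _ hfin, Finset.mul_sum]
    refine Finset.sum_bij (fun F _ => graft j F) ?_ ?_ ?_ ?_
    · intro F hF
      simp only [Finite.mem_toFinset, mem_ofPred_eq] at hF
      simp only [Finset.mem_filter, mem_treesF, card_graft, kc_graft_nil, and_true, hF]
      omega
    · intro a _ b _ h; exact graft_inj h
    · intro τ hτ
      simp only [Finset.mem_filter, mem_treesF] at hτ
      obtain ⟨h1, rfl⟩ := hτ
      refine ⟨τ.sub, ?_, graft_sub τ⟩
      have hc := card_graft (τ.kc []) τ.sub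
      rw [graft_sub] at hc
      simp only [Finite.mem_toFinset, mem_ofPred_eq]
      omega
    · intro F _
      rw [bgwW_graft]
  simp_rw [key]
  rw [Finset.sum_fiberwise_of_maps_to]
  intro τ hτ
  rw [mem_treesF] at hτ
  have hc := card_graft (τ.kc []) τ.sub
  rw [graft_sub] at hc
  have h1 : τ.kc [] ≤ ∑ i, (τ.sub i).verts.card := by
    calc τ.kc [] = ∑ i : Fin (τ.kc []), 1 := by simp
      _ ≤ _ := Finset.sum_le_sum fun i _ => (τ.sub i).card_pos
  rw [Finset.mem_range]; omega

/-- Offspring generating series. -/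
def oP (μ : ℕ → ℝ) : PowerSeries ℝ := PowerSeries.mk μ

/-- `cA μ n m` is the probability that the sum of `n` iid variables of law `μ` is `m`. -/
def cA (μ : ℕ → ℝ) (n m : ℕ) : ℝ := PowerSeries.coeff m (oP μ ^ n)

theorem tP_coeff_zero_of_lt (μ : ℕ → ℝ) {n k : ℕ} (h : n < k) :
    PowerSeries.coeff n (tP μ ^ k) = 0 := by
  have hX : (PowerSeries.X : PowerSeries ℝ) ∣ tP μ := by
    rw [PowerSeries.X_dvd_iff, ← PowerSeries.coeff_zero_eq_constantCoeff_apply]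
    simp [tP, tp_zero]
  exact (PowerSeries.X_pow_dvd_iff.mp (pow_dvd_pow_of_dvd hX k)) n h

theorem forest_rec (μ : ℕ → ℝ) (n k : ℕ) :
    PowerSeries.coeff (n + 1) (tP μ ^ (k + 1)) =
      ∑ j ∈ Finset.range (n + 1), μ j * PowerSeries.coeff n (tP μ ^ (k + j)) := by
  have h1 : tP μ = PowerSeries.X * PowerSeries.mk (fun n => tp μ (n + 1)) := by
    ext m
    cases m with
    | zero => simp [tP, tp_zero]
    | succ m => rw [PowerSeries.coeff_succ_X_mul]; simp [tP]
  have h0 : tP μ ^ (k + 1) = PowerSeries.X * (PowerSeries.mk (fun n => tp μ (n + 1)) * tP μ ^ k) := by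
    rw [pow_succ', ← mul_assoc, ← h1]
  rw [h0, PowerSeries.coeff_succ_X_mul, PowerSeries.coeff_mul]
  have h2 : ∀ j, PowerSeries.coeff n (tP μ ^ (k + j)) =
     ∑ p ∈ Finset.HasAntidiagonal.antidiagonal n, PowerSeries.coeff p.1 (tP μ ^ j) * PowerSeries.coeff p.2 (tP μ ^ k) := by
    intro j
    rw [add_comm, pow_add, PowerSeries.coeff_mul]
  simp_rw [h2, Finset.mul_sum]
  rw [Finset.sum_comm]
  refine Finset.sum_congr rfl fun p hp => ?_
  have hp' : p.1 ≤ n := by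
    have := Finset.HasAntidiagonal.mem_antidiagonal.mp hp; omega
  simp_rw [← mul_assoc]
  rw [← Finset.sum_mul]
  congr 1
  rw [PowerSeries.coeff_mk, tp_succ]
  apply Finset.sum_subset
  · intro j; simp only [Finset.mem_range]; omega
  · intro j _ hj
    simp only [Finset.mem_range] at hj
    rw [tP_coeff_zero_of_lt μ (by omega), mul_zero]

theorem cA_deriv (μ : ℕ → ℝ) (n M : ℕ) :
    ((n : ℝ) + 1) * ∑ p ∈ Finset.HasAntidiagonal.antidiagonal M, (p.1 : ℝ) * μ p.1 * cA μ n p.2 =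
      M * cA μ (n + 1) M := by
  have h := PowerSeries.derivative_pow (R := ℝ) (oP μ) (n + 1)
  have h2 : PowerSeries.coeff M (PowerSeries.X * PowerSeries.derivative ℝ (oP μ ^ (n + 1))) =
      M * cA μ (n + 1) M := by
    cases M with
    | zero => simp
    | succ M =>
      rw [PowerSeries.coeff_succ_X_mul, PowerSeries.coeff_derivative]
      simp [cA, mul_comm]
  have h3 : PowerSeries.coeff M (PowerSeries.X * PowerSeries.derivative ℝ (oP μ) * oP μ ^ n) =
      ∑ p ∈ Finset.HasAntidiagonal.antidiagonal M, (p.1 : ℝ) * μ p.1 * cA μ n p.2 := by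
    rw [PowerSeries.coeff_mul]
    refine Finset.sum_congr rfl fun p _ => ?_
    unfold cA
    congr 1
    obtain ⟨a, b⟩ := p
    cases a with
    | zero => simp
    | succ a =>
      rw [PowerSeries.coeff_succ_X_mul, PowerSeries.coeff_derivative]
      simp [oP, mul_comm]
  rw [← h2, ← h3, h]
  have : PowerSeries.X * (((n + 1 : ℕ) : PowerSeries ℝ) * oP μ ^ (n + 1 - 1) * PowerSeries.derivative ℝ (oP μ))
    = PowerSeries.C ((n : ℝ) + 1) * (PowerSeries.X * PowerSeries.derivative ℝ (oP μ) * oP μ ^ n) := by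
    simp only [add_tsub_cancel_right, Nat.cast_add, Nat.cast_one, map_add, map_one]
    rw [show (PowerSeries.C (n : ℝ) : PowerSeries ℝ) = (n : PowerSeries ℝ) from map_natCast _ n]
    ring
  rw [this, PowerSeries.coeff_C_mul]

theorem cA_succ (μ : ℕ → ℝ) (n M : ℕ) :
    cA μ (n + 1) M = ∑ p ∈ Finset.HasAntidiagonal.antidiagonal M, μ p.1 * cA μ n p.2 := by
  unfold cA
  rw [pow_succ', PowerSeries.coeff_mul]
  simp [oP]

theorem cA_add (μ : ℕ → ℝ) (n m M : ℕ) :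
    cA μ (n + m) M = ∑ p ∈ Finset.HasAntidiagonal.antidiagonal M, cA μ n p.1 * cA μ m p.2 := by
  unfold cA
  rw [pow_add, PowerSeries.coeff_mul]

theorem otter_dwass (μ : ℕ → ℝ) (n k : ℕ) (h : k ≤ n) :
    (n : ℝ) * PowerSeries.coeff n (tP μ ^ k) = k * cA μ n (n - k) := by
  induction n generalizing k with
  | zero =>
    obtain rfl : k = 0 := by omega
    simp
  | succ n ih =>
    cases k with
    | zero => simp
    | succ k =>
      rw [forest_rec]
      rcases Nat.eq_zero_or_pos n with rfl | hn
      · obtain rfl : k = 0 := by omega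
        simp [cA, oP]
      have e1 : ∑ j ∈ Finset.range (n + 1), μ j * PowerSeries.coeff n (tP μ ^ (k + j)) =
          ∑ p ∈ Finset.HasAntidiagonal.antidiagonal (n - k), μ p.1 * PowerSeries.coeff n (tP μ ^ (k + p.1)) := by
        rw [Finset.Nat.sum_antidiagonal_eq_sum_range_succ_mk]
        symm
        apply Finset.sum_subset
        · intro j; simp only [Finset.mem_range]; omega
        · intro j _ hj
          simp only [Finset.mem_range] at hj
          rw [tP_coeff_zero_of_lt μ (by omega), mul_zero]
      have e2 : (n : ℝ) * ∑ p ∈ Finset.HasAntidiagonal.antidiagonal (n - k), μ p.1 * PowerSeries.coeff n (tP μ ^ (k + p.1))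
          = k * cA μ (n + 1) (n - k) +
            ∑ p ∈ Finset.HasAntidiagonal.antidiagonal (n - k), (p.1 : ℝ) * μ p.1 * cA μ n p.2 := by
        rw [cA_succ, Finset.mul_sum, Finset.mul_sum, ← Finset.sum_add_distrib]
        refine Finset.sum_congr rfl fun p hp => ?_
        have hp' := Finset.HasAntidiagonal.mem_antidiagonal.mp hp
        have := ih (k + p.1) (by omega)
        rw [show n - (k + p.1) = p.2 by omega] at this
        push_cast at this
        linear_combination μ p.1 * this
      have e3 := cA_deriv μ n (n - k)
      rw [e1]
      have hn' : (n : ℝ) ≠ 0 := by positivity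
      apply mul_left_cancel₀ hn'
      rw [show n + 1 - (k + 1) = n - k by omega]
      rw [Nat.cast_sub (by omega)] at e3
      push_cast
      linear_combination ((n : ℝ) + 1) * e2 + e3

theorem tp_eq (μ : ℕ → ℝ) (n : ℕ) : ((n : ℝ) + 1) * tp μ (n + 1) = cA μ (n + 1) n := by
  have := otter_dwass μ (n + 1) 1 (by omega)
  simpa [tP] using this

theorem cA_nonneg (μ : ℕ → ℝ) (h : ∀ j, 0 ≤ μ j) (n m : ℕ) : 0 ≤ cA μ n m := by
  induction n generalizing m with
  | zero => unfold cA; simp only [pow_zero, PowerSeries.coeff_one]; split_ifs <;> norm_num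
  | succ n ih =>
    rw [cA_succ]
    exact Finset.sum_nonneg fun p _ => mul_nonneg (h _) (ih _)

/-- powers of summable nonneg series -/
theorem pow_hasSum {𝕜 : Type*} [NormedField 𝕜] [CompleteSpace 𝕜] (P : PowerSeries 𝕜)
    (hs : Summable fun n => ‖PowerSeries.coeff n P‖) (k : ℕ) :
    (Summable fun n => ‖PowerSeries.coeff n (P ^ k)‖) ∧
    HasSum (fun n => PowerSeries.coeff n (P ^ k)) ((∑' n, PowerSeries.coeff n P) ^ k) := by
  induction k with
  | zero =>
    simp only [pow_zero]
    constructor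
    · apply summable_of_hasFiniteSupport
      apply (Set.finite_singleton 0).subset
      intro n hn
      by_contra h
      simp [PowerSeries.coeff_one] at hn h
      exact h hn
    · convert hasSum_ite_eq 0 (1 : 𝕜) using 2
      rename_i n
      rw [PowerSeries.coeff_one]
  | succ k ih =>
    have e : (fun n => PowerSeries.coeff n (P ^ (k + 1))) = fun n => ∑ p ∈ Finset.HasAntidiagonal.antidiagonal n,
       PowerSeries.coeff p.1 (P ^ k) * PowerSeries.coeff p.2 P := by
      funext n
      rw [pow_succ, PowerSeries.coeff_mul]
    have s1 := summable_norm_sum_mul_antidiagonal_of_summable_norm ih.1 hs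
    have s2 := tsum_mul_tsum_eq_tsum_sum_antidiagonal_of_summable_norm ih.1 hs
    constructor
    · simp_rw [congrFun e]; exact s1
    · rw [e, pow_succ, ← ih.2.tsum_eq, s2]
      exact (Summable.of_norm s1).hasSum

theorem tP_pow_nonneg (μ : ℕ → ℝ) (h : ∀ j, 0 ≤ μ j) (k n : ℕ) :
    0 ≤ PowerSeries.coeff n (tP μ ^ k) := by
  rw [tP_pow_coeff]
  exact Finset.sum_nonneg fun s _ => Finset.prod_nonneg fun i _ => tp_nonneg μ h _

theorem tP_partial (μ : ℕ → ℝ) (h : ∀ j, 0 ≤ μ j) (N k : ℕ) :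
    ∑ n ∈ Finset.range N, PowerSeries.coeff n (tP μ ^ k) ≤ (∑ n ∈ Finset.range N, tp μ n) ^ k := by
  classical
  induction k with
  | zero =>
    simp only [pow_zero, PowerSeries.coeff_one]
    rw [Finset.sum_ite_eq']
    split_ifs <;> norm_num
  | succ k ih =>
    have hN : 0 ≤ ∑ n ∈ Finset.range N, tp μ n := Finset.sum_nonneg fun n _ => tp_nonneg μ h n
    rw [pow_succ (∑ n ∈ Finset.range N, tp μ n)]
    refine le_trans ?_ (mul_le_mul_of_nonneg_right ih hN)
    rw [Finset.sum_mul_sum, ← Finset.sum_product']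
    have hdisj : ((Finset.range N : Finset ℕ) : Set ℕ).PairwiseDisjoint
        (fun n => Finset.HasAntidiagonal.antidiagonal n) := by
      intro a _ b _ hab
      simp only [Function.onFun]
      rw [Finset.disjoint_left]
      intro p hp hp'
      have e1 := Finset.HasAntidiagonal.mem_antidiagonal.mp hp
      have e2 := Finset.HasAntidiagonal.mem_antidiagonal.mp hp'
      exact hab (by omega)
    have e : ∑ n ∈ Finset.range N, PowerSeries.coeff n (tP μ ^ (k + 1)) =
        ∑ p ∈ (Finset.range N).biUnion (fun n => Finset.HasAntidiagonal.antidiagonal n),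
          PowerSeries.coeff p.1 (tP μ ^ k) * tp μ p.2 := by
      rw [Finset.sum_biUnion hdisj]
      refine Finset.sum_congr rfl fun n _ => ?_
      rw [pow_succ, PowerSeries.coeff_mul]
      simp [tP]
    rw [e]
    apply Finset.sum_le_sum_of_subset_of_nonneg
    · intro p hp
      simp only [Finset.mem_biUnion, Finset.mem_range, Finset.HasAntidiagonal.mem_antidiagonal,
        Finset.mem_product] at hp ⊢
      omega
    · intro p _ _
      exact mul_nonneg (tP_pow_nonneg μ h _ _) (tp_nonneg μ h _)

theorem tp_partial_le (μ : ℕ → ℝ) (h : ∀ j, 0 ≤ μ j) (hs : HasSum μ 1) (N : ℕ) :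
    ∑ n ∈ Finset.range N, tp μ n ≤ 1 := by
  induction N with
  | zero => simp
  | succ N ih =>
    rcases Nat.eq_zero_or_pos N with rfl | hN
    · simp [tp_zero]
    rw [Finset.sum_range_succ', tp_zero, add_zero]
    have h0 : 0 ≤ ∑ n ∈ Finset.range N, tp μ n := Finset.sum_nonneg fun n _ => tp_nonneg μ h n
    calc ∑ n ∈ Finset.range N, tp μ (n + 1)
        = ∑ n ∈ Finset.range N, ∑ j ∈ Finset.range N, μ j * PowerSeries.coeff n (tP μ ^ j) := by
          refine Finset.sum_congr rfl fun n hn => ?_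
          rw [Finset.mem_range] at hn
          rw [tp_succ]
          apply Finset.sum_subset
          · intro j; simp only [Finset.mem_range]; omega
          · intro j _ hj
            simp only [Finset.mem_range] at hj
            rw [tP_coeff_zero_of_lt μ (by omega), mul_zero]
      _ = ∑ j ∈ Finset.range N, μ j * ∑ n ∈ Finset.range N, PowerSeries.coeff n (tP μ ^ j) := by
          rw [Finset.sum_comm]
          simp_rw [Finset.mul_sum]
      _ ≤ ∑ j ∈ Finset.range N, μ j := by
          refine Finset.sum_le_sum fun j _ => ?_
          exact mul_le_of_le_one_right (h j) ((tP_partial μ h N j).trans (pow_le_one₀ h0 ih))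
      _ ≤ 1 := sum_le_hasSum _ (fun j _ => h j) hs

theorem swap_aux (μ : ℕ → ℝ) (c : ℕ → ℕ → ℝ) (t : ℕ → ℝ) (h : ∀ j, 0 ≤ μ j) (hc : ∀ j n, 0 ≤ c j n)
    (hpow : ∀ j, HasSum (c j) (t j)) (hsm : Summable (fun j => μ j * t j)) :
    ∑' n, ∑' j, μ j * c j n = ∑' j, ∑' n, μ j * c j n := by
  have hprod : Summable (fun p : ℕ × ℕ => μ p.1 * c p.1 p.2) := by
    rw [summable_prod_of_nonneg (fun p => mul_nonneg (h _) (hc _ _))]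
    refine ⟨fun j => ((hpow j).mul_left (μ j)).summable, ?_⟩
    refine hsm.congr fun j => ?_
    exact (((hpow j).mul_left (μ j)).tsum_eq).symm
  exact Summable.tsum_comm (f := fun j n => μ j * c j n) hprod

theorem tp_hasSum (μ : ℕ → ℝ) (h : ∀ j, 0 ≤ μ j) (hs : HasSum μ 1) (hμ01 : μ 0 + μ 1 < 1)
    (hcrit : HasSum (fun j : ℕ => (j : ℝ) * μ j) 1) : HasSum (tp μ) 1 := by
  have hsum : Summable (tp μ) := summable_of_sum_range_le (tp_nonneg μ h) (tp_partial_le μ h hs)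
  have hle : ∑' n, tp μ n ≤ 1 := hsum.tsum_le_of_sum_range_le (tp_partial_le μ h hs)
  have h0 : 0 ≤ ∑' n, tp μ n := tsum_nonneg (tp_nonneg μ h)
  set T := ∑' n, tp μ n with hT
  have hpow : ∀ j, HasSum (fun n => PowerSeries.coeff n (tP μ ^ j)) (T ^ j) := by
    intro j
    have := (pow_hasSum (tP μ) (by simpa [tP] using hsum.norm) j).2
    simpa [tP] using this
  -- fixed point
  have hfix : HasSum (fun j => μ j * T ^ j) T := by
    have hsm : Summable (fun j => μ j * T ^ j) :=
      Summable.of_nonneg_of_le (fun j => mul_nonneg (h j) (pow_nonneg h0 j))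
        (fun j => mul_le_of_le_one_right (h j) (pow_le_one₀ h0 hle)) hs.summable
    have e := swap_aux μ (fun j n => PowerSeries.coeff n (tP μ ^ j)) (fun j => T ^ j) h
      (fun j n => tP_pow_nonneg μ h j n) hpow hsm
    have e1 : ∀ n, ∑' j, μ j * PowerSeries.coeff n (tP μ ^ j) = tp μ (n + 1) := by
      intro n
      rw [tp_succ]
      apply tsum_eq_sum
      intro j hj
      simp only [Finset.mem_range] at hj
      rw [tP_coeff_zero_of_lt μ (by omega), mul_zero]
    have e2 : ∀ j, ∑' n, μ j * PowerSeries.coeff n (tP μ ^ j) = μ j * T ^ j :=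
      fun j => ((hpow j).mul_left _).tsum_eq
    simp_rw [e1, e2] at e
    have e3 := hsum.tsum_eq_zero_add
    rw [tp_zero, zero_add] at e3
    rw [← e3] at e
    have e4 := hsm.hasSum
    rw [← e] at e4
    exact e4
  have hT1 : T = 1 := by
    by_contra hne
    have hlt : T < 1 := lt_of_le_of_ne hle hne
    have hz : HasSum (fun j : ℕ => μ j * (T ^ j - 1 + j * (1 - T))) 0 := by
      have := (hfix.sub hs).add (hcrit.mul_right (1 - T))
      rw [show T - 1 + 1 * (1 - T) = 0 by ring] at this
      have hfun : (fun j : ℕ => μ j * (T ^ j - 1 + j * (1 - T))) =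
          fun j : ℕ => μ j * T ^ j - μ j + j * μ j * (1 - T) := by funext j; ring
      rw [hfun]; exact this
    have hnn : ∀ j : ℕ, 0 ≤ μ j * (T ^ j - 1 + j * (1 - T)) := by
      intro j
      apply mul_nonneg (h j)
      have := one_add_mul_le_pow (a := T - 1) (by linarith) j
      rw [show 1 + (T - 1) = T by ring] at this
      linarith
    have hall := (hasSum_zero_iff_of_nonneg hnn).mp hz
    have hzero : ∀ j : ℕ, 2 ≤ j → μ j = 0 := by
      intro j hj
      have := congrFun hall j
      simp only [Pi.zero_apply, mul_eq_zero] at this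
      rcases this with h' | h'
      · exact h'
      · exfalso
        have hb := one_add_mul_le_pow (a := T - 1) (by linarith) (j - 1)
        rw [show 1 + (T - 1) = T by ring] at hb
        have hj' : ((j - 1 : ℕ) : ℝ) = j - 1 := by rw [Nat.cast_sub (by omega)]; simp
        rw [hj'] at hb
        have hTj : T ^ j = T * T ^ (j - 1) := by rw [← pow_succ']; congr 1; omega
        rw [hTj] at h'
        have hj2 : (2 : ℝ) ≤ j := by exact_mod_cast hj
        nlinarith [mul_le_mul_of_nonneg_left hb h0, mul_pos (sub_pos.mpr hlt) (sub_pos.mpr hlt)]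
    have : HasSum μ (∑ j ∈ Finset.range 2, μ j) := by
      apply hasSum_sum_of_ne_finset_zero
      intro j hj
      simp only [Finset.mem_range, not_lt] at hj
      exact hzero j hj
    have := this.unique hs
    simp [Finset.sum_range_succ] at this
    linarith
  rw [← hT1]; exact hsum.hasSum

/-- Convolution lemma. -/
theorem conv_asymp (p a b : ℕ → ℝ) (A B SA SB : ℝ) (C : ℝ) (hp : ∀ᶠ n in atTop, 0 < p n)
    (hratio : Tendsto (fun n => p (n + 1) / p n) atTop (nhds 1))
    (hdom : ∀ᶠ n in atTop, ∀ j, j ≤ n → n ≤ 2 * j → p j ≤ C * p n)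
    (ha : Tendsto (fun n => a n / p n) atTop (nhds A))
    (hb : Tendsto (fun n => b n / p n) atTop (nhds B))
    (hsa : HasSum (fun n => ‖a n‖) SA) (hsb : HasSum (fun n => ‖b n‖) SB) :
    Tendsto (fun n => (∑ q ∈ Finset.HasAntidiagonal.antidiagonal n, a q.1 * b q.2) / p n) atTop
      (nhds (A * (∑' n, b n) + B * ∑' n, a n)) := by
  -- shift
  have hshift : ∀ j : ℕ, Tendsto (fun n => p n / p (n + j)) atTop (nhds 1) := by
    intro j
    induction j with
    | zero =>
      refine Tendsto.congr' ?_ tendsto_const_nhds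
      filter_upwards [hp] with n hn
      simp [hn.ne']
    | succ j ih =>
      have h1 : Tendsto (fun n => p (n + j) / p (n + (j + 1))) atTop (nhds 1) := by
        have := (hratio.comp (tendsto_add_atTop_nat j)).inv₀ one_ne_zero
        simp only [inv_one] at this
        refine this.congr fun n => ?_
        simp [add_assoc]
      have h2 := ih.mul h1
      rw [mul_one] at h2
      refine h2.congr' ?_
      filter_upwards [(tendsto_add_atTop_nat j).eventually hp] with n hn
      field_simp
  -- one-sided lemma
  have key : ∀ (x y : ℕ → ℝ) (Y SX : ℝ) (cond : ℕ → ℕ → Prop) [∀ j n, Decidable (cond j n)],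
      (∀ j n, cond j n → 2 * j ≤ n) → (∀ j, ∀ᶠ n in atTop, cond j n) →
      Tendsto (fun n => y n / p n) atTop (nhds Y) → HasSum (fun n => ‖x n‖) SX →
      Tendsto (fun n => ∑' j, if cond j n then x j * y (n - j) / p n else 0) atTop
        (nhds (Y * ∑' n, x n)) := by
    intro x y Y SX cond _ hc1 hc2 hy hx
    rw [← tsum_mul_left]
    have hbd : ∃ D : ℝ, 0 ≤ D ∧ ∀ᶠ n in atTop, |y n| ≤ D * p n := by
      refine ⟨|Y| + 1, by positivity, ?_⟩
      have := hy.abs.eventually (gt_mem_nhds (lt_add_one |Y|))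
      filter_upwards [this, hp] with n h1 h2
      rw [abs_div, abs_of_pos h2, div_lt_iff₀ h2] at h1
      exact h1.le
    obtain ⟨D, hD, hyD⟩ := hbd
    obtain ⟨N0, hN0⟩ := eventually_atTop.mp hyD
    obtain ⟨N1, hN1⟩ := eventually_atTop.mp hdom
    obtain ⟨N2, hN2⟩ := eventually_atTop.mp hp
    apply tendsto_tsum_of_dominated_convergence (bound := fun j => ‖x j‖ * (D * C))
    · exact hx.summable.mul_right _
    · intro j
      have h1 : Tendsto (fun n => x j * (y (n - j) / p (n - j) * (p (n - j) / p n))) atTop (nhds (Y * x j)) := by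
        have h2 : Tendsto (fun n => y (n - j) / p (n - j) * (p (n - j) / p n)) atTop (nhds (Y * 1)) := by
          rw [← tendsto_add_atTop_iff_nat j]
          simp only [add_tsub_cancel_right]
          exact hy.mul (hshift j)
        rw [mul_one] at h2
        rw [mul_comm Y]
        exact h2.const_mul (x j)
      refine h1.congr' ?_
      filter_upwards [hc2 j, eventually_ge_atTop (N2 + j)] with n hn hn2
      rw [if_pos hn]
      have := hN2 (n - j) (by omega)
      field_simp
    · filter_upwards [eventually_ge_atTop (2 * (N0 + N1 + N2))] with n hn j
      have hpn := hN2 n (by omega)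
      have hpos : 0 ≤ D * C := by
        have := hN1 n (by omega) n le_rfl (by omega)
        have : 1 ≤ C := by
          by_contra hC
          push Not at hC
          nlinarith
        positivity
      split_ifs with hcd
      · have h1 := hc1 j n hcd
        have h2 := hN1 n (by omega) (n - j) (by omega) (by omega)
        have h3 := hN0 (n - j) (by omega)
        rw [norm_div, norm_mul, Real.norm_of_nonneg hpn.le, div_le_iff₀ hpn, mul_assoc]
        apply mul_le_mul_of_nonneg_left _ (norm_nonneg _)
        rw [Real.norm_eq_abs]
        calc |y (n - j)| ≤ D * p (n - j) := h3
          _ ≤ D * (C * p n) := mul_le_mul_of_nonneg_left h2 hD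
          _ = _ := by ring
      · simp only [norm_zero]; positivity
  have k1 := key a b B SA (fun j n => 2 * j ≤ n) (fun _ _ h => h)
    (fun j => eventually_ge_atTop (2 * j)) hb hsa
  have k2 := key b a A SB (fun j n => 2 * j < n) (fun _ _ h => le_of_lt h)
    (fun j => eventually_gt_atTop (2 * j)) ha hsb
  have k3 := k2.add k1
  refine k3.congr fun n => ?_
  rw [tsum_eq_sum (s := Finset.range (n + 1)), tsum_eq_sum (s := Finset.range (n + 1))]
  · rw [Finset.Nat.sum_antidiagonal_eq_sum_range_succ_mk, Finset.sum_div]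
    have e1 : ∑ j ∈ Finset.range (n + 1), (if 2 * j < n then b j * a (n - j) / p n else 0)
      = ∑ j ∈ Finset.range (n + 1), (if 2 * j ≤ n then 0 else a j * b (n - j) / p n) := by
      rw [← Finset.sum_range_reflect]
      refine Finset.sum_congr rfl fun j hj => ?_
      rw [Finset.mem_range] at hj
      have hx : n + 1 - 1 - j = n - j := by omega
      rw [hx, show n - (n - j) = j by omega]
      by_cases hc : 2 * j ≤ n
      · rw [if_pos hc, if_neg (by omega)]
      · rw [if_neg hc, if_pos (by omega), mul_comm]
    rw [e1, ← Finset.sum_add_distrib]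
    refine Finset.sum_congr rfl fun j _ => ?_
    split_ifs <;> simp
  · intro j hj
    simp only [Finset.mem_range] at hj
    rw [if_neg (by omega)]
  · intro j hj
    simp only [Finset.mem_range] at hj
    rw [if_neg (by omega)]

theorem pow_asymp (μ : ℕ → ℝ) (hsum : HasSum (tp μ) 1) (C : ℝ)
    (hp : ∀ᶠ n in atTop, 0 < tp μ n)
    (hratio : Tendsto (fun n => tp μ (n + 1) / tp μ n) atTop (nhds 1))
    (hdom : ∀ᶠ n in atTop, ∀ j, j ≤ n → n ≤ 2 * j → tp μ j ≤ C * tp μ n) (k : ℕ) :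
    Tendsto (fun n => PowerSeries.coeff n (tP μ ^ k) / tp μ n) atTop (nhds k) := by
  have hn : Summable fun n => ‖PowerSeries.coeff n (tP μ)‖ := by
    simpa [tP] using hsum.summable.norm
  have hone : ∑' n, PowerSeries.coeff n (tP μ) = 1 := by
    simpa [tP] using hsum.tsum_eq
  induction k with
  | zero =>
    refine Tendsto.congr' ?_ (tendsto_const_nhds)
    filter_upwards [eventually_ge_atTop 1] with n hn
    rw [pow_zero, PowerSeries.coeff_one, if_neg (by omega)]; simp
  | succ k ih =>
    have hP := pow_hasSum (tP μ) hn k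
    have h2 : Tendsto (fun n => tp μ n / tp μ n) atTop (nhds 1) := by
      refine Tendsto.congr' ?_ tendsto_const_nhds
      filter_upwards [hp] with n hn
      rw [div_self hn.ne']
    have := conv_asymp (tp μ) (fun n => PowerSeries.coeff n (tP μ ^ k)) (tp μ) k 1 _ _ C hp hratio hdom
      ih h2 hP.1.hasSum hsum.summable.norm.hasSum
    rw [hsum.tsum_eq, hP.2.tsum_eq, hone] at this
    simp only [one_pow, mul_one] at this
    push_cast
    refine this.congr fun n => ?_
    rw [pow_succ, PowerSeries.coeff_mul]
    simp [tP]

theorem numer_eq (μ : ℕ → ℝ) (k m n : ℕ) (hn : 2 * m < n) :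
    ∑ᶠ F ∈ {F : Fin (k + 1) → PlaneTree | (∑ i, (F i).verts.card) = n ∧
            n - (Finset.univ.sup fun i => (F i).verts.card) = m}, ∏ i, bgwW μ (F i) =
    ((k + 1 : ℕ) : ℝ) * (tp μ (n - m) * PowerSeries.coeff m (tP μ ^ k)) := by
  classical
  set D : Finset (Fin (k + 1) → ℕ) := ((Finset.univ : Finset (Fin (k + 1))).piAntidiag n).filter
    (fun s => n - Finset.univ.sup s = m) with hD
  have e1 := forest_sum μ (k + 1) D
  have hset : {F : Fin (k + 1) → PlaneTree | (fun i => (F i).verts.card) ∈ D} =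
    {F : Fin (k + 1) → PlaneTree | (∑ i, (F i).verts.card) = n ∧
            n - (Finset.univ.sup fun i => (F i).verts.card) = m} := by
    ext F
    simp [hD]
  rw [hset] at e1
  rw [e1]
  have hDU : D = (Finset.univ : Finset (Fin (k + 1))).biUnion fun i =>
      ((Finset.univ : Finset (Fin k)).piAntidiag m).image (fun s => i.insertNth (n - m) s) := by
    ext s
    simp only [hD, Finset.mem_filter, Finset.mem_piAntidiag, Finset.mem_univ, implies_true, and_true,
      Finset.mem_biUnion, true_and, Finset.mem_image]
    constructor
    · rintro ⟨hs, hsup⟩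
      obtain ⟨i, _, hi⟩ := Finset.exists_mem_eq_sup (Finset.univ : Finset (Fin (k + 1))) ⟨0, Finset.mem_univ _⟩ s
      have hle : s i ≤ n := by
        rw [← hs]; exact Finset.single_le_sum (fun _ _ => Nat.zero_le _) (Finset.mem_univ i)
      have hsi : s i = n - m := by rw [hi] at hsup; omega
      refine ⟨i, i.removeNth s, ?_, ?_⟩
      · rw [Fin.sum_univ_succAbove _ i] at hs
        have hs2 : ∑ l, i.removeNth s l = ∑ l, s (i.succAbove l) := rfl
        rw [hs2]; omega
      · rw [← hsi]; simp
    · rintro ⟨i, t, ht, rfl⟩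
      have hsum : ∑ j, (i.insertNth (n - m) t : Fin (k + 1) → ℕ) j = n := by
        rw [Fin.sum_univ_succAbove _ i]
        simp only [Fin.insertNth_apply_same, Fin.insertNth_apply_succAbove, ht]
        omega
      refine ⟨hsum, ?_⟩
      have hsup : (Finset.univ : Finset (Fin (k + 1))).sup (i.insertNth (n - m) t : Fin (k + 1) → ℕ) = n - m := by
        apply le_antisymm
        · apply Finset.sup_le
          intro j _
          rcases Fin.eq_self_or_eq_succAbove i j with rfl | ⟨l, rfl⟩
          · simp
          · simp only [Fin.insertNth_apply_succAbove]
            have : t l ≤ m := by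
              rw [← ht]; exact Finset.single_le_sum (fun _ _ => Nat.zero_le _) (Finset.mem_univ l)
            omega
        · have := Finset.le_sup (f := (i.insertNth (n - m) t : Fin (k + 1) → ℕ)) (Finset.mem_univ i)
          simpa using this
      rw [hsup]; omega
  rw [hDU, Finset.sum_biUnion]
  · have : ∀ i : Fin (k + 1), ∑ s ∈ ((Finset.univ : Finset (Fin k)).piAntidiag m).image
        (fun s => (i.insertNth (n - m) s : Fin (k + 1) → ℕ)), ∏ j, tp μ (s j) =
        tp μ (n - m) * PowerSeries.coeff m (tP μ ^ k) := by
      intro i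
      rw [Finset.sum_image, tP_pow_coeff, Finset.mul_sum]
      · refine Finset.sum_congr rfl fun t _ => ?_
        rw [Fin.prod_univ_succAbove _ i]
        simp
      · intro a _ b _ hab
        funext l; have := congrFun hab (i.succAbove l); simpa using this
    rw [Finset.sum_congr rfl fun i _ => this i]
    simp
  · intro i _ i' _ hii
    simp only [Function.onFun]
    rw [Finset.disjoint_left]
    intro s hs hs'
    simp only [Finset.mem_image, Finset.mem_piAntidiag] at hs hs'
    obtain ⟨t, ht, rfl⟩ := hs
    obtain ⟨t', ht', he⟩ := hs'
    have h1 := congrFun he i'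
    simp only [Fin.insertNth_apply_same] at h1
    obtain ⟨l, hl⟩ := Fin.exists_succAbove_eq (Ne.symm hii)
    rw [← hl] at h1
    simp only [Fin.insertNth_apply_succAbove] at h1
    have : t l ≤ m := by
      rw [← ht.1]; exact Finset.single_le_sum (fun _ _ => Nat.zero_le _) (Finset.mem_univ l)
    omega

theorem final_of_reg (μ : ℕ → ℝ) (hsum : HasSum (tp μ) 1) (C : ℝ)
    (hp : ∀ᶠ n in atTop, 0 < tp μ n)
    (hratio : Tendsto (fun n => tp μ (n + 1) / tp μ n) atTop (nhds 1))
    (hdom : ∀ᶠ n in atTop, ∀ j, j ≤ n → n ≤ 2 * j → tp μ j ≤ C * tp μ n)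
    (k : ℕ) (hk : 1 ≤ k) (m : ℕ) :
    Tendsto (fun n : ℕ =>
        (∑ᶠ F ∈ {F : Fin k → PlaneTree | (∑ i, (F i).verts.card) = n ∧
            n - (Finset.univ.sup fun i => (F i).verts.card) = m}, ∏ i, bgwW μ (F i)) /
        (∑ᶠ F ∈ {F : Fin k → PlaneTree | (∑ i, (F i).verts.card) = n}, ∏ i, bgwW μ (F i)))
      atTop
      (nhds (∑ᶠ G ∈ {G : Fin (k - 1) → PlaneTree | (∑ i, (G i).verts.card) = m},
        ∏ i, bgwW μ (G i))) := by
  obtain ⟨k, rfl⟩ : ∃ k', k = k' + 1 := ⟨k - 1, by omega⟩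
  rw [forest_sum_eq μ (k + 1 - 1) m, Nat.add_sub_cancel]
  have hk := pow_asymp μ hsum C hp hratio hdom (k + 1)
  have hshift : ∀ j : ℕ, Tendsto (fun n => tp μ n / tp μ (n + j)) atTop (nhds 1) := by
    intro j
    induction j with
    | zero =>
      refine Tendsto.congr' ?_ tendsto_const_nhds
      filter_upwards [hp] with n hn
      simp [hn.ne']
    | succ j ih =>
      have h1 : Tendsto (fun n => tp μ (n + j) / tp μ (n + (j + 1))) atTop (nhds 1) := by
        have := (hratio.comp (tendsto_add_atTop_nat j)).inv₀ one_ne_zero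
        simp only [inv_one] at this
        refine this.congr fun n => ?_
        simp [add_assoc]
      have h2 := ih.mul h1
      rw [mul_one] at h2
      refine h2.congr' ?_
      filter_upwards [(tendsto_add_atTop_nat j).eventually hp] with n hn
      field_simp
  have hs : Tendsto (fun n => tp μ (n - m) / tp μ n) atTop (nhds 1) := by
    rw [← tendsto_add_atTop_iff_nat m]
    simpa using hshift m
  have hk0 : ((k + 1 : ℕ) : ℝ) ≠ 0 := by positivity
  have hlim := (((hs.mul_const (PowerSeries.coeff m (tP μ ^ k))).const_mul ((k + 1 : ℕ) : ℝ)).div hk hk0)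
  rw [one_mul, mul_div_cancel_left₀ _ hk0] at hlim
  refine hlim.congr' ?_
  filter_upwards [hp, eventually_gt_atTop (2 * m)] with n hn hm
  have e1 := numer_eq μ k m n hm
  have e2 := forest_sum_eq μ (k + 1) n
  simp only [Set.mem_ofPred_eq] at e1 e2 ⊢
  rw [e1, e2]
  simp only [Pi.div_apply]
  field_simp

/-- Standing hypotheses on the offspring law. -/
structure OffHyp (μ : ℕ → ℝ) : Prop where
  nn : ∀ j, 0 ≤ μ j
  sum : HasSum μ 1
  pos : 0 < μ 0
  crit : HasSum (fun j : ℕ => (j : ℝ) * μ j) 1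
  aper : ∀ d : ℕ, (∀ i : ℕ, 0 < i → 0 < μ i → d ∣ i) → d = 1

def ph (x : ℝ) : ℝ := min (x ^ 2) x

def dd (j : ℕ) : ℝ := |(j : ℝ) - 1|

lemma dd_nonneg (j : ℕ) : 0 ≤ dd j := abs_nonneg _

lemma dd_le (j : ℕ) : dd j ≤ j + 1 := by
  unfold dd
  have : (0:ℝ) ≤ j := by positivity
  rw [abs_le]; constructor <;> linarith

lemma ph_nonneg {x : ℝ} (hx : 0 ≤ x) : 0 ≤ ph x := le_min (by positivity) hx

lemma ph_le (x : ℝ) : ph x ≤ x := min_le_right _ _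

lemma ph_le_sq (x : ℝ) : ph x ≤ x ^ 2 := min_le_left _ _

lemma ph_mono {x y : ℝ} (hx : 0 ≤ x) (hxy : x ≤ y) : ph x ≤ ph y :=
  min_le_min (by gcongr) hxy

lemma ph_scale_ge {l x : ℝ} (hl : 1 ≤ l) (hx : 0 ≤ x) : l * ph x ≤ ph (l * x) := by
  unfold ph
  rw [mul_min_of_nonneg _ _ (by linarith)]
  refine min_le_min ?_ le_rfl
  have : 0 ≤ x ^ 2 * l * (l - 1) := by
    have : 0 ≤ l - 1 := by linarith
    positivity
  nlinarith

lemma ph_scale_le {l x : ℝ} (hl : 1 ≤ l) (hx : 0 ≤ x) : ph (l * x) ≤ l ^ 2 * ph x := by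
  unfold ph
  rw [mul_min_of_nonneg _ _ (by positivity)]
  refine min_le_min (by rw [mul_pow]) ?_
  have : 0 ≤ x * l * (l - 1) := by
    have : 0 ≤ l - 1 := by linarith
    positivity
  nlinarith

lemma ph_cont : Continuous ph := by unfold ph; fun_prop

def hh (μ : ℕ → ℝ) (t : ℝ) : ℝ := ∑' j, μ j * ph (t * dd j)

def QQ (μ : ℕ → ℝ) (t : ℝ) : ℝ := ∑' j, μ j * (if t * dd j ≤ 1 then (t * dd j) ^ 2 else 0)

namespace OffHyp
variable {μ : ℕ → ℝ}

lemma sdd (H : OffHyp μ) : Summable fun j => μ j * dd j := by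
  refine Summable.of_nonneg_of_le (fun j => mul_nonneg (H.nn j) (dd_nonneg j))
    (fun j => mul_le_mul_of_nonneg_left (dd_le j) (H.nn j)) ?_
  refine (H.crit.add H.sum).summable.congr fun j => ?_
  ring

lemma tdd (H : OffHyp μ) : ∑' j, μ j * dd j ≤ 2 := by
  have h1 := H.crit.add H.sum
  have : ∑' j : ℕ, ((j:ℝ) * μ j + μ j) = 1 + 1 := h1.tsum_eq
  calc _ ≤ ∑' j : ℕ, ((j:ℝ) * μ j + μ j) := by
        refine H.sdd.tsum_le_tsum (fun j => ?_) h1.summable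
        have := mul_le_mul_of_nonneg_left (dd_le j) (H.nn j)
        linarith
    _ ≤ 2 := by rw [this]; norm_num

lemma sh (H : OffHyp μ) {t : ℝ} (ht : 0 ≤ t) : Summable fun j => μ j * ph (t * dd j) := by
  have hp : ∀ j, 0 ≤ t * dd j := fun j => mul_nonneg ht (dd_nonneg j)
  refine Summable.of_nonneg_of_le (fun j => mul_nonneg (H.nn j) (ph_nonneg (hp j)))
    (fun j => mul_le_mul_of_nonneg_left (ph_le _) (H.nn j)) ?_
  refine (H.sdd.mul_left t).congr fun j => ?_
  ring

lemma Qterm_nonneg (H : OffHyp μ) (t : ℝ) (j : ℕ) :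
    0 ≤ μ j * (if t * dd j ≤ 1 then (t * dd j) ^ 2 else 0) := by
  refine mul_nonneg (H.nn j) ?_
  split_ifs <;> positivity

lemma Qterm_le (H : OffHyp μ) {t : ℝ} (ht : 0 ≤ t) (j : ℕ) :
    μ j * (if t * dd j ≤ 1 then (t * dd j) ^ 2 else 0) ≤ μ j * ph (t * dd j) := by
  have hp : 0 ≤ t * dd j := mul_nonneg ht (dd_nonneg j)
  refine mul_le_mul_of_nonneg_left ?_ (H.nn j)
  split_ifs with h
  · exact le_min le_rfl (by nlinarith)
  · exact ph_nonneg hp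

lemma sQ (H : OffHyp μ) {t : ℝ} (ht : 0 ≤ t) :
    Summable fun j => μ j * (if t * dd j ≤ 1 then (t * dd j) ^ 2 else 0) :=
  Summable.of_nonneg_of_le (H.Qterm_nonneg t) (H.Qterm_le ht) (H.sh ht)

lemma hh_nonneg (H : OffHyp μ) {t : ℝ} (ht : 0 ≤ t) : 0 ≤ hh μ t :=
  tsum_nonneg fun j => mul_nonneg (H.nn j) (ph_nonneg (mul_nonneg ht (dd_nonneg j)))

lemma hh_zero (H : OffHyp μ) : hh μ 0 = 0 := by simp [hh, ph]

lemma hh_mono (H : OffHyp μ) {s t : ℝ} (hs : 0 ≤ s) (hst : s ≤ t) : hh μ s ≤ hh μ t := by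
  refine (H.sh hs).tsum_le_tsum (fun j => ?_) (H.sh (hs.trans hst))
  exact mul_le_mul_of_nonneg_left (ph_mono (mul_nonneg hs (dd_nonneg j))
    (mul_le_mul_of_nonneg_right hst (dd_nonneg j))) (H.nn j)

lemma hh_scale_ge (H : OffHyp μ) {l t : ℝ} (hl : 1 ≤ l) (ht : 0 ≤ t) :
    l * hh μ t ≤ hh μ (l * t) := by
  unfold hh
  rw [← tsum_mul_left]
  refine ((H.sh ht).mul_left l).tsum_le_tsum (fun j => ?_) (H.sh (by positivity))
  have := mul_le_mul_of_nonneg_left (ph_scale_ge hl (mul_nonneg ht (dd_nonneg j))) (H.nn j)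
  rw [mul_assoc l t]
  linarith

lemma hh_scale_le (H : OffHyp μ) {l t : ℝ} (hl : 1 ≤ l) (ht : 0 ≤ t) :
    hh μ (l * t) ≤ l ^ 2 * hh μ t := by
  unfold hh
  rw [← tsum_mul_left]
  refine (H.sh (by positivity)).tsum_le_tsum (fun j => ?_) ((H.sh ht).mul_left _)
  have := mul_le_mul_of_nonneg_left (ph_scale_le hl (mul_nonneg ht (dd_nonneg j))) (H.nn j)
  rw [mul_assoc l t]
  linarith

lemma hh_le (H : OffHyp μ) {t : ℝ} (ht : 0 ≤ t) : hh μ t ≤ 2 * t := by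
  have h1 : hh μ t ≤ ∑' j, t * (μ j * dd j) := by
    refine (H.sh ht).tsum_le_tsum (fun j => ?_) (H.sdd.mul_left t)
    have := mul_le_mul_of_nonneg_left (ph_le (t * dd j)) (H.nn j)
    linarith
  rw [tsum_mul_left] at h1
  nlinarith [H.tdd]

lemma hh_ge (H : OffHyp μ) {t : ℝ} (ht : 0 ≤ t) : μ 0 * ph t ≤ hh μ t := by
  have := (H.sh ht).le_tsum 0 (fun j _ =>
    mul_nonneg (H.nn j) (ph_nonneg (mul_nonneg ht (dd_nonneg j))))
  simpa [dd, hh] using this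

lemma Q_ge (H : OffHyp μ) {t : ℝ} (ht : 0 ≤ t) (ht1 : t ≤ 1) : μ 0 * t ^ 2 ≤ QQ μ t := by
  have := (H.sQ ht).le_tsum 0 (fun j _ => H.Qterm_nonneg t j)
  simpa [dd, ht1, QQ] using this

lemma hh_two (H : OffHyp μ) {t : ℝ} (ht : 0 ≤ t) :
    2 * hh μ t + 1 / 2 * QQ μ (2 * t) ≤ hh μ (2 * t) := by
  unfold hh QQ
  have h2 : 0 ≤ 2 * t := by positivity
  rw [← tsum_mul_left, ← tsum_mul_left,
    ← ((H.sh ht).mul_left 2).tsum_add ((H.sQ h2).mul_left _)]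
  refine (((H.sh ht).mul_left 2).add ((H.sQ h2).mul_left _)).tsum_le_tsum (fun j => ?_) (H.sh h2)
  have hp : 0 ≤ t * dd j := mul_nonneg ht (dd_nonneg j)
  have key : 2 * ph (t * dd j) + 1 / 2 * (if 2 * t * dd j ≤ 1 then (2 * t * dd j) ^ 2 else 0)
      ≤ ph (2 * t * dd j) := by
    split_ifs with h
    · have : ph (t * dd j) ≤ (t * dd j) ^ 2 := ph_le_sq _
      refine le_min ?_ ?_
      · nlinarith
      · nlinarith
    · have := ph_scale_ge (l := 2) (by norm_num) hp
      rw [mul_assoc 2 t]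
      linarith
  have := mul_le_mul_of_nonneg_left key (H.nn j)
  linarith

lemma hh_cont (H : OffHyp μ) (T : ℝ) : ContinuousOn (hh μ) (Icc 0 T) := by
  refine continuousOn_tsum (u := fun j => T * (μ j * dd j)) (fun j => ?_) (H.sdd.mul_left T) ?_
  · exact (continuous_const.mul (ph_cont.comp (by fun_prop))).continuousOn
  · intro j t ht
    have hp : 0 ≤ t * dd j := mul_nonneg ht.1 (dd_nonneg j)
    rw [Real.norm_of_nonneg (mul_nonneg (H.nn j) (ph_nonneg hp))]
    have h1 := mul_le_mul_of_nonneg_left (ph_le (t * dd j)) (H.nn j)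
    have h2 : t * (μ j * dd j) ≤ T * (μ j * dd j) :=
      mul_le_mul_of_nonneg_right ht.2 (mul_nonneg (H.nn j) (dd_nonneg j))
    linarith

/-- existence of the scaling sequence -/
lemma exists_a (H : OffHyp μ) : ∃ a : ℕ → ℝ, ∀ n, 1 ≤ n → 0 < a n ∧ hh μ (a n) = 1 / n := by
  have : ∀ n : ℕ, ∃ x : ℝ, 1 ≤ n → 0 < x ∧ hh μ x = 1 / n := by
    intro n
    by_cases hn : 1 ≤ n
    · set T : ℝ := 1 + 1 / μ 0 with hT
      have hT1 : 1 ≤ T := by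
        have := H.pos
        have : 0 < 1 / μ 0 := by positivity
        linarith
      have h1 : 1 ≤ hh μ T := by
        have := H.hh_ge (t := T) (by linarith)
        have e : ph T = T := by
          unfold ph
          exact min_eq_right (by nlinarith)
        rw [e] at this
        have e2 : μ 0 * T = μ 0 + 1 := by
          rw [hT]
          have := H.pos.ne'
          field_simp
        have := H.pos
        linarith
      have hn' : (1:ℝ) / n ≤ 1 := by
        rw [div_le_one (by positivity)]
        exact_mod_cast hn
      obtain ⟨x, hx, hxe⟩ := intermediate_value_Icc (by linarith : (0:ℝ) ≤ T) (H.hh_cont T)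
        (show (1:ℝ) / n ∈ Icc (hh μ 0) (hh μ T) from ⟨by rw [H.hh_zero]; positivity, by linarith⟩)
      refine ⟨x, fun _ => ⟨lt_of_le_of_ne hx.1 ?_, hxe⟩⟩
      rintro rfl
      rw [H.hh_zero] at hxe
      have : (0:ℝ) < 1 / n := by positivity
      linarith
    · exact ⟨0, fun h => absurd h hn⟩
  choose a ha using this
  exact ⟨a, ha⟩

end OffHyp

def tail (f : ℕ → ℝ) (n : ℕ) : ℝ := ∑' k : ℕ, {m : ℕ | n ≤ m}.indicator f k

lemma tail_tendsto (f : ℕ → ℝ) (hf : Summable f) : Tendsto (tail f) atTop (nhds 0) := by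
  have h1 : ∀ n, tail f n = (∑' k, f k) - ∑ k ∈ Finset.range n, f k := by
    intro n
    have h2 : HasSum (({m : ℕ | n ≤ m}ᶜ).indicator f) (∑ k ∈ Finset.range n, f k) := by
      have : ({m : ℕ | n ≤ m}ᶜ) = ((Finset.range n : Finset ℕ) : Set ℕ) := by
        ext k; simp
      rw [this, ← hasSum_subtype_iff_indicator]
      exact Finset.hasSum _ _
    have h3 := (hf.indicator {m : ℕ | n ≤ m}).hasSum.add h2
    have h4 : (fun k => {m : ℕ | n ≤ m}.indicator f k + ({m : ℕ | n ≤ m}ᶜ).indicator f k) = f := by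
      funext k
      exact congrFun (Set.indicator_self_add_compl {m : ℕ | n ≤ m} f) k
    rw [h4] at h3
    rw [h3.tsum_eq]
    unfold tail
    ring
  have h2 := (tendsto_const_nhds (x := ∑' k, f k)).sub hf.hasSum.tendsto_sum_nat
  rw [sub_self] at h2
  exact h2.congr fun n => (h1 n).symm

namespace OffHyp
variable {μ : ℕ → ℝ}

/-- `R n ≤ 2 n G n + R (2 * n)` -/
lemma tail_step (H : OffHyp μ) (n : ℕ) :
    tail (fun j : ℕ => (j:ℝ) * μ j) n ≤ 2 * n * tail μ n + tail (fun j : ℕ => (j:ℝ) * μ j) (2 * n) := by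
  unfold tail
  have s1 := H.crit.summable.indicator {m : ℕ | n ≤ m}
  have s2 := H.crit.summable.indicator {m : ℕ | 2 * n ≤ m}
  have s3 := (H.sum.summable.indicator {m : ℕ | n ≤ m}).mul_left (2 * (n:ℝ))
  rw [← tsum_mul_left, ← s3.tsum_add s2]
  refine s1.tsum_le_tsum (fun j => ?_) (s3.add s2)
  have hj := H.nn j
  by_cases h1 : n ≤ j
  · by_cases h2 : 2 * n ≤ j
    · simp [Set.indicator, h1, h2]; positivity
    · have : (j:ℝ) ≤ 2 * n := by exact_mod_cast (by omega : j ≤ 2 * n)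
      simp [Set.indicator, h1, h2]
      exact mul_le_mul_of_nonneg_right this hj
  · have h2 : ¬ 2 * n ≤ j := by omega
    simp [Set.indicator, h1, h2]

lemma tail_nonneg (H : OffHyp μ) (n : ℕ) : 0 ≤ tail μ n :=
  tsum_nonneg fun j => Set.indicator_nonneg (fun i _ => H.nn i) j

lemma tail_R (H : OffHyp μ) {ρ : ℝ} (hρ0 : 0 ≤ ρ) (hρ : ρ < 1 / 2) {n0 : ℕ} (hn0 : 1 ≤ n0)
    (h : ∀ n, n0 ≤ n → tail μ (2 * n) ≤ ρ * tail μ n) (n : ℕ) (hn : n0 ≤ n) :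
    tail (fun j : ℕ => (j:ℝ) * μ j) n ≤ 2 / (1 - 2 * ρ) * n * tail μ n := by
  set K := 2 / (1 - 2 * ρ) with hK
  have hpos : 0 < 1 - 2 * ρ := by linarith
  have hK2 : 2 + 2 * ρ * K = K := by rw [hK]; field_simp; ring
  have hK0 : 0 ≤ K := by rw [hK]; positivity
  have ind : ∀ k : ℕ, ∀ n, n0 ≤ n → tail (fun j : ℕ => (j:ℝ) * μ j) n ≤
      K * n * tail μ n + tail (fun j : ℕ => (j:ℝ) * μ j) (2 ^ k * n) := by
    intro k
    induction k with
    | zero =>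
      intro n hn
      have := H.tail_nonneg n
      have : 0 ≤ K * n * tail μ n := by positivity
      simpa using this
    | succ k ih =>
      intro n hn
      have h1 := H.tail_step n
      have h2 := ih (2 * n) (by omega)
      have h3 := h n hn
      have h4 : K * (2 * n) * tail μ (2 * n) ≤ K * (2 * n) * (ρ * tail μ n) :=
        mul_le_mul_of_nonneg_left h3 (by positivity)
      have e : 2 ^ (k + 1) * n = 2 ^ k * (2 * n) := by ring
      rw [e]
      push_cast at h2
      have h5 : K * n * tail μ n = 2 * n * tail μ n + K * (2 * n) * (ρ * tail μ n) := by
        linear_combination (- (n:ℝ) * tail μ n) * hK2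
      linarith
  have ht : Tendsto (fun k : ℕ => 2 ^ k * n) atTop atTop := by
    refine tendsto_atTop_mono (fun k => ?_) tendsto_id
    have h1 : k < 2 ^ k := Nat.lt_two_pow_self
    have h2 : 2 ^ k * 1 ≤ 2 ^ k * n := Nat.mul_le_mul_left _ (by omega)
    simp only [id]
    omega
  have hl := ((tail_tendsto _ H.crit.summable).comp ht).const_add (K * n * tail μ n)
  rw [add_zero] at hl
  exact ge_of_tendsto' hl fun k => ind k n hn

lemma Hcond_tail (H : OffHyp μ) {ρ : ℝ} (hρ0 : 0 ≤ ρ) (hρ : ρ < 1 / 2) {n0 : ℕ} (hn0 : 1 ≤ n0)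
    (h : ∀ n, n0 ≤ n → tail μ (2 * n) ≤ ρ * tail μ n) :
    ∃ c : ℝ, 0 < c ∧ ∀ t : ℝ, 0 < t → t ≤ 1 → c * hh μ t ≤ QQ μ t := by
  set K := 2 / (1 - 2 * ρ) with hK
  have hpos : 0 < 1 - 2 * ρ := by linarith
  have hK0 : 0 ≤ K := by rw [hK]; positivity
  set t0 : ℝ := 1 / (2 * (n0 + 1)) with ht0
  have ht0p : 0 < t0 := by positivity
  have hmain : ∀ t : ℝ, 0 < t → t ≤ t0 → hh μ t ≤ (1 + 16 * K) * QQ μ t := by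
    intro t htp htt
    set y := 1 / t with hy
    have hty : t * y = 1 := by rw [hy]; field_simp
    have hyp : 0 < y := by positivity
    have hy2 : 2 * (n0 + 1 : ℝ) ≤ y := by
      rw [hy, le_div_iff₀ htp]
      rw [ht0, le_div_iff₀ (by positivity)] at htt
      linarith
    set n := ⌊y / 2⌋₊ + 1 with hn
    have hn1 : (n : ℝ) - 1 ≤ y / 2 := by
      rw [hn]; push_cast
      have := Nat.floor_le (by positivity : 0 ≤ y / 2)
      linarith
    have hn2 : y / 2 < n := by
      rw [hn]; push_cast
      exact Nat.lt_floor_add_one _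
    have hn0n : n0 ≤ n := by
      have : (n0 : ℝ) < n := by linarith
      exact_mod_cast this.le
    have hn2' : (2:ℝ) ≤ n := by
      have h1 : (1:ℝ) ≤ n0 := by exact_mod_cast hn0
      linarith
    have htn : 1 / 2 ≤ t * n := by nlinarith
    have hG := h n hn0n
    have hR := H.tail_R hρ0 hρ hn0 h n hn0n
    have hG0 := H.tail_nonneg n
    -- lower bound on Q
    have hQ : (t * n) ^ 2 / 4 * (tail μ n - tail μ (2 * n)) ≤ QQ μ t := by
      unfold tail QQ
      have s1 := H.sum.summable.indicator {m : ℕ | n ≤ m}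
      have s2 := H.sum.summable.indicator {m : ℕ | 2 * n ≤ m}
      rw [← s1.tsum_sub s2, ← tsum_mul_left]
      refine ((s1.sub s2).mul_left _).tsum_le_tsum (fun j => ?_) (H.sQ htp.le)
      by_cases h1 : n ≤ j
      · by_cases h2 : 2 * n ≤ j
        · have := H.Qterm_nonneg t j
          simpa [Set.indicator, h1, h2] using this
        · have hj1 : (n:ℝ) ≤ j := by exact_mod_cast h1
          have hj2 : (j:ℝ) + 1 ≤ 2 * n := by exact_mod_cast (by omega : j + 1 ≤ 2 * n)
          have hd : dd j = j - 1 := by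
            unfold dd; exact abs_of_nonneg (by linarith)
          have hle : t * dd j ≤ 1 := by rw [hd]; nlinarith
          rw [if_pos hle]
          simp only [Set.indicator, Set.mem_ofPred_eq, h1, h2, if_true, if_false, sub_zero]
          rw [mul_comm]
          refine mul_le_mul_of_nonneg_left ?_ (H.nn j)
          rw [hd]
          have h3 : t * n / 2 ≤ t * (j - 1) := by nlinarith
          have h4 : 0 ≤ t * n / 2 := by positivity
          calc (t * n) ^ 2 / 4 = (t * n / 2) ^ 2 := by ring
            _ ≤ _ := by gcongr
      · have h2 : ¬ 2 * n ≤ j := by omega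
        have := H.Qterm_nonneg t j
        simpa [Set.indicator, h1, h2] using this
    have hh1 : hh μ t ≤ QQ μ t + t * tail (fun j : ℕ => (j:ℝ) * μ j) n := by
      unfold tail QQ hh
      have s1 := (H.crit.summable.indicator {m : ℕ | n ≤ m}).mul_left t
      rw [← tsum_mul_left, ← (H.sQ htp.le).tsum_add s1]
      refine (H.sh htp.le).tsum_le_tsum (fun j => ?_) ((H.sQ htp.le).add s1)
      have hj := H.nn j
      have hind : 0 ≤ {m : ℕ | n ≤ m}.indicator (fun j : ℕ => (j:ℝ) * μ j) j :=
        Set.indicator_nonneg (fun i _ => mul_nonneg (by positivity) (H.nn i)) j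
      by_cases h1 : t * dd j ≤ 1
      · rw [if_pos h1]
        have := mul_le_mul_of_nonneg_left (ph_le_sq (t * dd j)) hj
        have := mul_nonneg htp.le hind
        linarith
      · rw [if_neg h1]
        push Not at h1
        have hyd : y < dd j := by
          by_contra hc
          push Not at hc
          nlinarith
        have hjj : y < j - 1 := by
          rcases abs_cases ((j:ℝ) - 1) with ⟨h5, h6⟩ | ⟨h5, h6⟩
          · unfold dd at hyd; linarith
          · unfold dd at hyd
            have h7 : (0:ℝ) ≤ j := by positivity
            have h8 : (1:ℝ) ≤ n0 := by exact_mod_cast hn0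
            linarith
        have hnj : n ≤ j := by
          have : (n:ℝ) ≤ j := by linarith
          exact_mod_cast this
        have hd : dd j = j - 1 := by
          unfold dd; exact abs_of_nonneg (by linarith)
        simp only [Set.indicator, Set.mem_ofPred_eq, hnj, if_true]
        have := mul_le_mul_of_nonneg_left (ph_le (t * dd j)) hj
        have h9 : μ j * (t * dd j) ≤ μ j * (t * j) := by
          refine mul_le_mul_of_nonneg_left (mul_le_mul_of_nonneg_left ?_ htp.le) hj
          linarith
        linarith
    have hb : t * n * tail μ n ≤ 16 * QQ μ t := by
      have h1 : 1 / 2 * tail μ n ≤ tail μ n - tail μ (2 * n) := by nlinarith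
      have h2 : (t * n) ^ 2 / 4 * (1 / 2 * tail μ n) ≤ (t * n) ^ 2 / 4 * (tail μ n - tail μ (2 * n)) :=
        mul_le_mul_of_nonneg_left h1 (by positivity)
      have h3 : 1 / 2 * (t * n * tail μ n) ≤ (t * n) * (t * n * tail μ n) :=
        mul_le_mul_of_nonneg_right htn (by positivity)
      nlinarith
    have h5 : t * tail (fun j : ℕ => (j:ℝ) * μ j) n ≤ t * (K * n * tail μ n) :=
      mul_le_mul_of_nonneg_left hR htp.le
    have h6 : K * (t * n * tail μ n) ≤ K * (16 * QQ μ t) := mul_le_mul_of_nonneg_left hb hK0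
    nlinarith
  refine ⟨min (1 / (1 + 16 * K)) (μ 0 * t0 ^ 2 / 2), lt_min (by positivity) ?_, ?_⟩
  · have := H.pos
    positivity
  · intro t htp ht1
    have hh0 := H.hh_nonneg htp.le
    rcases le_total t t0 with h1 | h1
    · have := hmain t htp h1
      calc _ ≤ 1 / (1 + 16 * K) * hh μ t := mul_le_mul_of_nonneg_right (min_le_left _ _) hh0
        _ ≤ 1 / (1 + 16 * K) * ((1 + 16 * K) * QQ μ t) :=
            mul_le_mul_of_nonneg_left this (by positivity)
        _ = QQ μ t := by field_simp
    · have h2 := H.hh_le htp.le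
      have h3 := H.Q_ge htp.le ht1
      have h4 := H.pos
      calc _ ≤ μ 0 * t0 ^ 2 / 2 * hh μ t := mul_le_mul_of_nonneg_right (min_le_right _ _) hh0
        _ ≤ μ 0 * t0 ^ 2 / 2 * 2 := by
            refine mul_le_mul_of_nonneg_left ?_ (by positivity)
            linarith
        _ = μ 0 * t0 ^ 2 := by ring
        _ ≤ μ 0 * t ^ 2 := by gcongr
        _ ≤ _ := h3

lemma Hcond_var (H : OffHyp μ) (hv : Summable fun k : ℕ => (k : ℝ) ^ 2 * μ k) :
    ∃ c : ℝ, 0 < c ∧ ∀ t : ℝ, 0 < t → t ≤ 1 → c * hh μ t ≤ QQ μ t := by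
  have sv : Summable fun j => μ j * dd j ^ 2 := by
    refine Summable.of_nonneg_of_le (fun j => mul_nonneg (H.nn j) (by positivity))
      (fun j => ?_) ((hv.mul_left 1).add H.sum.summable)
    have h1 : dd j ^ 2 ≤ (j:ℝ) ^ 2 + 1 := by
      unfold dd
      rw [sq_abs]
      have : (0:ℝ) ≤ j := by positivity
      nlinarith
    have := mul_le_mul_of_nonneg_left h1 (H.nn j)
    linarith
  set V := ∑' j, μ j * dd j ^ 2 with hV
  have hV0 : 0 ≤ V := tsum_nonneg fun j => mul_nonneg (H.nn j) (by positivity)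
  have h0 := H.pos
  refine ⟨μ 0 / (V + 1), by positivity, fun t htp ht1 => ?_⟩
  have h1 : hh μ t ≤ t ^ 2 * V := by
    rw [hV, ← tsum_mul_left]
    refine (H.sh htp.le).tsum_le_tsum (fun j => ?_) (sv.mul_left _)
    have := mul_le_mul_of_nonneg_left (ph_le_sq (t * dd j)) (H.nn j)
    linarith
  have h3 := H.Q_ge htp.le ht1
  rw [div_mul_eq_mul_div, div_le_iff₀ (by positivity)]
  have h4 : μ 0 * hh μ t ≤ μ 0 * (t ^ 2 * V) := mul_le_mul_of_nonneg_left h1 h0.le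
  have h5 : μ 0 * t ^ 2 * (V + 1) ≤ QQ μ t * (V + 1) := by gcongr
  nlinarith [mul_nonneg h0.le (sq_nonneg t)]

lemma Hcond (H : OffHyp μ) {α : ℝ} (hα1 : 1 < α) (hdom : DomAttr μ α) :
    ∃ c : ℝ, 0 < c ∧ ∀ t : ℝ, 0 < t → t ≤ 1 → c * hh μ t ≤ QQ μ t := by
  rcases hdom with ⟨-, hv⟩ | ⟨-, g, hg, hslow, htail⟩
  · exact H.Hcond_var hv
  · have hp2 : (2:ℝ) ^ (-α) < 1 / 2 := by
      have : (2:ℝ) ^ (-α) < 2 ^ (-1 : ℝ) := Real.rpow_lt_rpow_of_exponent_lt (by norm_num) (by linarith)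
      rwa [Real.rpow_neg_one, ← one_div] at this
    have hpp : (0:ℝ) < 2 ^ (-α) := by positivity
    obtain ⟨ρ, hρ1, hρ2⟩ := exists_between hp2
    have h1 := ((hslow 2 (by norm_num)).comp tendsto_natCast_atTop_atTop).mul_const ((2:ℝ) ^ (-α))
    rw [one_mul] at h1
    obtain ⟨n0, hn0⟩ := eventually_atTop.1 (h1.eventually_lt_const hρ1)
    refine H.Hcond_tail (ρ := ρ) (by linarith) hρ2 (n0 := n0 + 1) (by omega) fun n hn => ?_
    have h2 := hn0 n (by omega)
    have e1 : tail μ n = g n * (n:ℝ) ^ (-α) := htail n (by omega)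
    have e2 : tail μ (2 * n) = g (2 * n) * ((2:ℝ) ^ (-α) * (n:ℝ) ^ (-α)) := by
      have := htail (2 * n) (by omega)
      push_cast at this
      rw [Real.mul_rpow (by norm_num) (by positivity)] at this
      exact this
    have hnp : (0:ℝ) < n := by exact_mod_cast (by omega : 0 < n)
    have hgn := hg n hnp
    have hnα : (0:ℝ) < (n:ℝ) ^ (-α) := by positivity
    simp only [Function.comp] at h2
    rw [e1, e2]
    have h3 : g (2 * n) * 2 ^ (-α) ≤ ρ * g n := by
      rw [div_mul_eq_mul_div, div_lt_iff₀ hgn] at h2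
      exact h2.le
    have := mul_le_mul_of_nonneg_right h3 hnα.le
    linarith

end OffHyp

namespace OffHyp
variable {μ : ℕ → ℝ}

lemma hh_pos (H : OffHyp μ) {t : ℝ} (ht : 0 < t) : 0 < hh μ t := by
  refine lt_of_lt_of_le ?_ (H.hh_ge ht.le)
  exact mul_pos H.pos (lt_min (by positivity) ht)

lemma hh_strict (H : OffHyp μ) {s t : ℝ} (hs : 0 < s) (hst : s < t) : hh μ s < hh μ t := by
  have hl : 1 < t / s := by rwa [one_lt_div hs]
  have h1 := H.hh_scale_ge hl.le hs.le
  rw [div_mul_cancel₀ _ hs.ne'] at h1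
  have := H.hh_pos hs
  nlinarith

lemma hh_power1 (H : OffHyp μ) {θ γ : ℝ} (hθ : 2 < θ) (hγ : (2:ℝ) ^ γ = θ) (hγ1 : 1 < γ)
    (h2 : ∀ t : ℝ, 0 < t → 2 * t ≤ 1 → θ * hh μ t ≤ hh μ (2 * t)) (i : ℕ) :
    ∀ s t : ℝ, 0 < s → s ≤ t → t ≤ 1 → t ≤ 2 ^ i * s → hh μ s * t ^ γ ≤ θ * hh μ t * s ^ γ := by
  have base : ∀ s t : ℝ, 0 < s → s ≤ t → t ≤ 2 * s → hh μ s * t ^ γ ≤ θ * hh μ t * s ^ γ := by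
    intro s t hs hst h
    have h3 : t ^ γ ≤ θ * s ^ γ := by
      rw [← hγ, ← Real.mul_rpow (by norm_num) hs.le]
      exact Real.rpow_le_rpow (by linarith) h (by linarith)
    have h4 := H.hh_mono hs.le hst
    have h5 := H.hh_pos hs
    calc hh μ s * t ^ γ ≤ hh μ t * (θ * s ^ γ) := by
          have : 0 ≤ t ^ γ := Real.rpow_nonneg (by linarith) _
          gcongr
          exact h5.le.trans h4
      _ = _ := by ring
  induction i with
  | zero =>
    intro s t hs hst ht1 h
    exact base s t hs hst (by linarith)
  | succ i ih =>
    intro s t hs hst ht1 h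
    rcases le_total t (2 * s) with h3 | h3
    · exact base s t hs hst h3
    · have h4 := ih s (t / 2) hs (by linarith) (by linarith) (by rw [pow_succ] at h; linarith)
      have h5 := h2 (t / 2) (by linarith) (by linarith)
      rw [show 2 * (t / 2) = t by ring] at h5
      rw [Real.div_rpow (by linarith) (by norm_num), hγ] at h4
      have h6 : hh μ s * t ^ γ = θ * (hh μ s * (t ^ γ / θ)) := by field_simp
      rw [h6]
      have hsγ : 0 ≤ s ^ γ := Real.rpow_nonneg hs.le _
      calc θ * (hh μ s * (t ^ γ / θ)) ≤ θ * (θ * hh μ (t / 2) * s ^ γ) :=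
            mul_le_mul_of_nonneg_left h4 (by linarith)
        _ = θ * (θ * hh μ (t / 2)) * s ^ γ := by ring
        _ ≤ θ * hh μ t * s ^ γ := by gcongr

lemma hh_power (H : OffHyp μ) {c : ℝ} (hc : 0 < c)
    (hQ : ∀ t : ℝ, 0 < t → t ≤ 1 → c * hh μ t ≤ QQ μ t) (A : ℝ) (hA : 1 ≤ A) :
    ∃ γ C : ℝ, 1 < γ ∧ 0 < C ∧ ∀ s t : ℝ, 0 < s → s ≤ t → t ≤ A →
      hh μ s * t ^ γ ≤ C * hh μ t * s ^ γ := by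
  set c' := min c 1 with hc'
  have hc'0 : 0 < c' := lt_min hc one_pos
  have hc'1 : c' ≤ 1 := min_le_right _ _
  set θ := 2 / (1 - c' / 2) with hθd
  have hden : 0 < 1 - c' / 2 := by linarith
  have hθ : 2 < θ := by
    rw [hθd, lt_div_iff₀ hden]; linarith
  set γ := Real.logb 2 θ with hγd
  have hγ : (2:ℝ) ^ γ = θ := Real.rpow_logb (by norm_num) (by norm_num) (by linarith)
  have hγ1 : 1 < γ := by
    rw [hγd, Real.lt_logb_iff_rpow_lt (by norm_num) (by linarith)]
    simpa using hθ
  have h2 : ∀ t : ℝ, 0 < t → 2 * t ≤ 1 → θ * hh μ t ≤ hh μ (2 * t) := by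
    intro t ht ht1
    have h3 := H.hh_two ht.le
    have h4 := hQ (2 * t) (by linarith) ht1
    have h5 := H.hh_pos (t := 2 * t) (by linarith)
    have h6 : c' * hh μ (2 * t) ≤ c * hh μ (2 * t) :=
      mul_le_mul_of_nonneg_right (min_le_left _ _) h5.le
    rw [hθd, div_mul_eq_mul_div, div_le_iff₀ hden]
    linarith
  have key : ∀ s t : ℝ, 0 < s → s ≤ t → t ≤ 1 → hh μ s * t ^ γ ≤ θ * hh μ t * s ^ γ := by
    intro s t hs hst ht
    obtain ⟨i, hi⟩ := pow_unbounded_of_one_lt (t / s) (by norm_num : (1:ℝ) < 2)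
    rw [div_lt_iff₀ hs] at hi
    exact H.hh_power1 hθ hγ hγ1 h2 i s t hs hst ht hi.le
  have hAγ : 1 ≤ A ^ γ := Real.one_le_rpow hA (by linarith)
  refine ⟨γ, θ * A ^ γ, hγ1, by positivity, fun s t hs hst htA => ?_⟩
  have hsγ : 0 < s ^ γ := Real.rpow_pos_of_pos hs _
  have hth : 0 < hh μ t := H.hh_pos (by linarith)
  have hsh := H.hh_pos hs
  have htγ : t ^ γ ≤ A ^ γ := Real.rpow_le_rpow (by linarith) htA (by linarith)
  have hm := H.hh_mono hs.le hst
  rcases le_total t 1 with h | h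
  · refine (key s t hs hst h).trans ?_
    have : θ * hh μ t * s ^ γ * 1 ≤ θ * hh μ t * s ^ γ * A ^ γ :=
      mul_le_mul_of_nonneg_left hAγ (by positivity)
    linarith
  · rcases le_total s 1 with h' | h'
    · have h3 := key s 1 hs h' le_rfl
      rw [Real.one_rpow, mul_one] at h3
      have h4 := H.hh_mono zero_le_one h
      calc hh μ s * t ^ γ ≤ (θ * hh μ 1 * s ^ γ) * A ^ γ := by
            have : 0 ≤ t ^ γ := Real.rpow_nonneg (by linarith) _
            gcongr
            exact hsh.le.trans h3
        _ ≤ (θ * hh μ t * s ^ γ) * A ^ γ := by gcongr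
        _ = _ := by ring
    · have h3 : 1 ≤ s ^ γ := Real.one_le_rpow h' (by linarith)
      calc hh μ s * t ^ γ ≤ hh μ t * A ^ γ := by gcongr
        _ ≤ (θ * s ^ γ) * (hh μ t * A ^ γ) := by
            refine le_mul_of_one_le_left (by positivity) ?_
            nlinarith
        _ = _ := by ring

end OffHyp

/-- the scaling sequence -/
structure SeqA (μ : ℕ → ℝ) (a : ℕ → ℝ) : Prop where
  pos : ∀ n, 1 ≤ n → 0 < a n
  eq : ∀ n, 1 ≤ n → hh μ (a n) = 1 / n

namespace SeqA
variable {μ a : ℕ → ℝ}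

lemma anti (S : SeqA μ a) (H : OffHyp μ) {m n : ℕ} (hm : 1 ≤ m) (h : m ≤ n) : a n ≤ a m := by
  by_contra hc
  push Not at hc
  have := H.hh_strict (S.pos m hm) hc
  rw [S.eq m hm, S.eq n (hm.trans h)] at this
  have h2 : (1:ℝ) / n ≤ 1 / m := one_div_le_one_div_of_le (by positivity) (by exact_mod_cast h)
  linarith

lemma scale (S : SeqA μ a) (H : OffHyp μ) {m n : ℕ} (hm : 1 ≤ m) {l : ℝ} (hl : 1 ≤ l)
    (hn : 1 ≤ n) (h : (n:ℝ) ≤ l * m) : a m ≤ l * a n := by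
  by_contra hc
  push Not at hc
  have hp := S.pos n hn
  have := H.hh_strict (by positivity) hc
  have h2 := H.hh_scale_ge hl hp.le
  rw [S.eq n hn] at h2
  rw [S.eq m hm] at this
  have hm0 : (0:ℝ) < m := by positivity
  have hn0 : (0:ℝ) < n := by positivity
  have h3 : (1:ℝ) / m ≤ l * (1 / n) := by
    rw [mul_one_div, div_le_div_iff₀ hm0 hn0]; linarith
  linarith

lemma lin (S : SeqA μ a) (H : OffHyp μ) {n : ℕ} (hn : 1 ≤ n) {t : ℝ} (ht : 0 ≤ t) :
    t / a n - 1 ≤ n * hh μ t := by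
  have hp := S.pos n hn
  have hn0 : (0:ℝ) < n := by positivity
  rcases le_total t (a n) with h | h
  · have h1 : t / a n ≤ 1 := by rwa [div_le_one hp]
    have := H.hh_nonneg ht
    have : 0 ≤ n * hh μ t := by positivity
    linarith
  · have h1 : 1 ≤ t / a n := by rwa [one_le_div hp]
    have h2 := H.hh_scale_ge h1 hp.le
    rw [div_mul_cancel₀ _ hp.ne', S.eq n hn] at h2
    have h3 := mul_le_mul_of_nonneg_left h2 hn0.le
    have h4 : (n:ℝ) * (t / a n * (1 / n)) = t / a n := by field_simp
    linarith

lemma tendsto (S : SeqA μ a) (H : OffHyp μ) : Tendsto a atTop (nhds 0) := by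
  rw [Metric.tendsto_atTop]
  intro e he
  have h0 := H.hh_pos he
  obtain ⟨N, hN⟩ := exists_nat_gt (1 / hh μ e)
  refine ⟨N + 1, fun n hn => ?_⟩
  have hn1 : 1 ≤ n := by omega
  rw [Real.dist_eq, sub_zero, abs_of_pos (S.pos n hn1)]
  by_contra hc
  push Not at hc
  have h1 := H.hh_mono he.le hc
  rw [S.eq n hn1] at h1
  have hn' : (N:ℝ) < n := by exact_mod_cast (by omega : N < n)
  have h2 : 1 / hh μ e < n := hN.trans hn'
  rw [div_lt_iff₀ h0] at h2
  rw [le_div_iff₀ (by positivity)] at h1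
  linarith

lemma power (S : SeqA μ a) (H : OffHyp μ) {c : ℝ} (hc : 0 < c)
    (hQ : ∀ t : ℝ, 0 < t → t ≤ 1 → c * hh μ t ≤ QQ μ t) :
    ∃ β C : ℝ, 0 < β ∧ β < 1 ∧ 0 < C ∧ ∀ j n : ℕ, 1 ≤ j → j ≤ n →
      a j ≤ C * ((n:ℝ) / j) ^ β * a n := by
  obtain ⟨γ, C, hγ, hC, h⟩ := H.hh_power hc hQ (max 1 (a 1)) (le_max_left _ _)
  refine ⟨1 / γ, C ^ (1 / γ), by positivity, ?_, by positivity, fun j n hj hjn => ?_⟩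
  · rw [div_lt_one (by linarith)]; exact hγ
  have hn := hj.trans hjn
  have hpn := S.pos n hn
  have hpj := S.pos j hj
  have hj0 : (0:ℝ) < j := by positivity
  have hn0 : (0:ℝ) < n := by positivity
  have h1 := h (a n) (a j) hpn (S.anti H hj hjn) ((S.anti H le_rfl hj).trans (le_max_right _ _))
  rw [S.eq n hn, S.eq j hj] at h1
  have h2 : a j ^ γ ≤ C * ((n:ℝ) / j) * a n ^ γ := by
    have h3 := mul_le_mul_of_nonneg_left h1 hn0.le
    calc a j ^ γ = n * (1 / n * a j ^ γ) := by field_simp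
      _ ≤ _ := h3
      _ = _ := by field_simp
  have h3 := Real.rpow_le_rpow (by positivity) h2 (by positivity : 0 ≤ 1 / γ)
  rw [← Real.rpow_mul hpj.le, Real.mul_rpow (by positivity) (by positivity),
    Real.mul_rpow (by positivity) (by positivity), ← Real.rpow_mul hpn.le,
    mul_one_div_cancel (by linarith), Real.rpow_one, Real.rpow_one] at h3
  exact h3

end SeqA

/-- `exp(i x)` -/
def ee (x : ℝ) : ℂ := Complex.exp (Complex.I * x)

lemma ee_norm (x : ℝ) : ‖ee x‖ = 1 := Complex.norm_exp_I_mul_ofReal x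

lemma ee_add (x y : ℝ) : ee (x + y) = ee x * ee y := by
  unfold ee; rw [← Complex.exp_add]; push_cast; ring_nf

lemma ee_zero : ee 0 = 1 := by simp [ee]

lemma ee_pow (x : ℝ) (n : ℕ) : ee x ^ n = ee (n * x) := by
  unfold ee; rw [← Complex.exp_nat_mul]; push_cast; ring_nf

lemma ee_cont : Continuous ee := by unfold ee; fun_prop

lemma ee_re (x : ℝ) : (ee x).re = Real.cos x := by
  unfold ee; rw [mul_comm, Complex.exp_ofReal_mul_I_re]

lemma ee_sub_le (x : ℝ) : ‖ee x - 1‖ ≤ |x| := Real.norm_exp_I_mul_ofReal_sub_one_le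

lemma ee_sub2_le (x : ℝ) : ‖ee x - 1 - Complex.I * x‖ ≤ 2 * ph |x| := by
  unfold ph
  have hn : ‖Complex.I * (x:ℂ)‖ = |x| := by simp
  rcases le_total |x| 1 with h | h
  · have h1 := Complex.norm_exp_sub_one_sub_id_le (x := Complex.I * (x:ℂ)) (by rw [hn]; exact h)
    rw [hn] at h1
    have h2 : min (|x| ^ 2) |x| = |x| ^ 2 := min_eq_left (by nlinarith [abs_nonneg x])
    rw [h2]
    unfold ee
    nlinarith [sq_nonneg |x|]
  · have h2 : min (|x| ^ 2) |x| = |x| := min_eq_right (by nlinarith [abs_nonneg x])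
    rw [h2]
    have h3 := norm_sub_le (ee x - 1) (Complex.I * x)
    have h4 := ee_sub_le x
    rw [hn] at h3
    linarith

def psi (μ : ℕ → ℝ) (t : ℝ) : ℂ := ∑' j : ℕ, (μ j : ℂ) * ee (((j:ℝ) - 1) * t)

namespace OffHyp
variable {μ : ℕ → ℝ}

lemma spsi (H : OffHyp μ) (t : ℝ) : Summable fun j : ℕ => (μ j : ℂ) * ee (((j:ℝ) - 1) * t) := by
  refine Summable.of_norm_bounded H.sum.summable fun j => ?_
  rw [norm_mul, ee_norm, mul_one, Complex.norm_real, Real.norm_of_nonneg (H.nn j)]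

lemma psi_cont (H : OffHyp μ) : Continuous (psi μ) := by
  refine continuous_tsum (u := μ) (fun j => ?_) H.sum.summable fun j t => ?_
  · exact continuous_const.mul (ee_cont.comp (by fun_prop))
  · rw [norm_mul, ee_norm, mul_one, Complex.norm_real, Real.norm_of_nonneg (H.nn j)]

lemma hasSum_one_sub (H : OffHyp μ) (t : ℝ) :
    HasSum (fun j : ℕ => (μ j : ℂ) * (1 - ee (((j:ℝ) - 1) * t))) (1 - psi μ t) := by
  have h1 : HasSum (fun j => (μ j : ℂ)) ((1:ℝ):ℂ) := Complex.hasSum_ofReal.2 H.sum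
  have h2 := h1.sub (H.spsi t).hasSum
  have hfun : (fun j : ℕ => (μ j : ℂ) - (μ j : ℂ) * ee (((j:ℝ) - 1) * t)) =
      fun j : ℕ => (μ j : ℂ) * (1 - ee (((j:ℝ) - 1) * t)) := by
    funext j; ring
  rw [hfun] at h2
  simpa [psi] using h2

lemma psi_upper (H : OffHyp μ) (t : ℝ) : ‖1 - psi μ t‖ ≤ 2 * hh μ |t| := by
  have h0 : HasSum (fun j : ℕ => ((((j:ℝ) * μ j - μ j : ℝ)) : ℂ)) (((1 - 1 : ℝ)) : ℂ) :=
    Complex.hasSum_ofReal.2 (H.crit.sub H.sum)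
  have h1 := (H.hasSum_one_sub t).add (h0.mul_left (Complex.I * t))
  have hfun : (fun j : ℕ => (μ j : ℂ) * (1 - ee (((j:ℝ) - 1) * t)) +
      Complex.I * t * ((((j:ℝ) * μ j - μ j : ℝ)) : ℂ)) =
      fun j : ℕ => (μ j : ℂ) * (-(ee (((j:ℝ) - 1) * t) - 1 - Complex.I * ((((j:ℝ) - 1) * t : ℝ)))) := by
    funext j; push_cast; ring
  rw [hfun] at h1
  simp only [sub_self, Complex.ofReal_zero, mul_zero, add_zero] at h1
  rw [← h1.tsum_eq]
  have hb : ∀ j : ℕ, ‖(μ j : ℂ) * (-(ee (((j:ℝ) - 1) * t) - 1 - Complex.I * ((((j:ℝ) - 1) * t : ℝ))))‖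
      ≤ 2 * (μ j * ph (|t| * dd j)) := by
    intro j
    rw [norm_mul, norm_neg, Complex.norm_real, Real.norm_of_nonneg (H.nn j)]
    have := mul_le_mul_of_nonneg_left (ee_sub2_le (((j:ℝ) - 1) * t)) (H.nn j)
    rw [abs_mul, mul_comm |(j:ℝ) - 1|] at this
    unfold dd
    linarith
  have := tsum_of_norm_bounded ((H.sh (abs_nonneg t)).hasSum.mul_left 2) hb
  exact this

lemma re_lower (H : OffHyp μ) (t : ℝ) : 2 / Real.pi ^ 2 * QQ μ |t| ≤ (1 - psi μ t).re := by
  have h1 := Complex.hasSum_re (H.hasSum_one_sub t)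
  have h2 := (H.sQ (abs_nonneg t)).hasSum.mul_left (2 / Real.pi ^ 2)
  refine hasSum_le (fun j => ?_) h2 h1
  rw [Complex.re_ofReal_mul, Complex.sub_re, Complex.one_re, ee_re]
  have hd : |t| * dd j = |((j:ℝ) - 1) * t| := by rw [abs_mul, mul_comm]; rfl
  have key : 2 / Real.pi ^ 2 * (if |t| * dd j ≤ 1 then (|t| * dd j) ^ 2 else 0)
      ≤ 1 - Real.cos (((j:ℝ) - 1) * t) := by
    split_ifs with h
    · rw [hd] at h ⊢
      rw [sq_abs]
      have := Real.cos_le_one_sub_mul_cos_sq (x := ((j:ℝ) - 1) * t)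
        (h.trans (by linarith [Real.pi_gt_three]))
      linarith
    · rw [mul_zero]
      linarith [Real.cos_le_one (((j:ℝ) - 1) * t)]
  have := mul_le_mul_of_nonneg_left key (H.nn j)
  linarith

lemma psi_norm_le (H : OffHyp μ) (t : ℝ) : ‖psi μ t‖ ≤ 1 := by
  refine tsum_of_norm_bounded H.sum fun j => ?_
  rw [norm_mul, ee_norm, mul_one, Complex.norm_real, Real.norm_of_nonneg (H.nn j)]

lemma psi_lt (H : OffHyp μ) {t : ℝ} (ht : 0 < |t|) (htp : |t| ≤ Real.pi) : ‖psi μ t‖ < 1 := by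
  refine lt_of_le_of_ne (H.psi_norm_le t) fun he => ?_
  set w := (starRingEnd ℂ) (psi μ t) with hw
  have hw1 : ‖w‖ = 1 := by rw [hw, Complex.norm_conj, he]
  have h1 := (H.spsi t).hasSum.mul_left w
  have h2 := Complex.hasSum_re h1
  have h3 : (w * ∑' j : ℕ, (μ j : ℂ) * ee (((j:ℝ) - 1) * t)).re = 1 := by
    change (w * psi μ t).re = 1
    rw [hw, Complex.conj_mul', he]; simp
  rw [h3] at h2
  have h4 := H.sum.sub h2
  rw [sub_self] at h4
  have hre : ∀ j : ℕ, (w * ((μ j : ℂ) * ee (((j:ℝ) - 1) * t))).re =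
      μ j * (w * ee (((j:ℝ) - 1) * t)).re := by
    intro j
    rw [mul_left_comm, Complex.re_ofReal_mul]
  have hn1 : ∀ j : ℕ, ‖w * ee (((j:ℝ) - 1) * t)‖ = 1 := fun j => by rw [norm_mul, hw1, ee_norm, one_mul]
  have hnn : ∀ j, 0 ≤ μ j - (w * ((μ j : ℂ) * ee (((j:ℝ) - 1) * t))).re := by
    intro j
    rw [hre]
    have h5 := Complex.re_le_norm (w * ee (((j:ℝ) - 1) * t))
    rw [hn1] at h5
    nlinarith [H.nn j]
  have h5 := (hasSum_zero_iff_of_nonneg hnn).1 h4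
  have h6 : ∀ j : ℕ, 0 < μ j → w * ee (((j:ℝ) - 1) * t) = 1 := by
    intro j hj
    have h7 := congrFun h5 j
    simp only [Pi.zero_apply] at h7
    rw [hre] at h7
    have h8 : (w * ee (((j:ℝ) - 1) * t)).re = 1 := by
      have : μ j * (1 - (w * ee (((j:ℝ) - 1) * t)).re) = 0 := by linarith
      rcases mul_eq_zero.1 this with h | h <;> linarith
    have h9 := hn1 j
    have h10 : (w * ee (((j:ℝ) - 1) * t)).im = 0 := by
      have := Complex.sq_norm (w * ee (((j:ℝ) - 1) * t))
      rw [h9, Complex.normSq_apply, h8] at this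
      have : (w * ee (((j:ℝ) - 1) * t)).im * (w * ee (((j:ℝ) - 1) * t)).im = 0 := by linarith
      exact mul_self_eq_zero.1 this
    exact Complex.ext (by simpa using h8) (by simpa using h10)
  have h00 := h6 0 H.pos
  have hz : ∀ j : ℕ, 0 < μ j → ee t ^ j = 1 := by
    intro j hj
    have h7 := h6 j hj
    have e1 : ee (((j:ℝ) - 1) * t) = ee (j * t) * ee (((0:ℕ) - 1 : ℝ) * t) := by
      rw [← ee_add]; congr 1; push_cast; ring
    rw [e1, mul_left_comm, h00, mul_one] at h7
    rw [ee_pow, h7]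
  have ho := H.aper (orderOf (ee t)) fun i _ hi => orderOf_dvd_iff_pow_eq_one.2 (hz i hi)
  rw [orderOf_eq_one_iff] at ho
  unfold ee at ho
  obtain ⟨n, hn⟩ := Complex.exp_eq_one_iff.1 ho
  have hn' : (t : ℂ) = ((n * (2 * Real.pi) : ℝ) : ℂ) := by
    have : Complex.I * (t:ℂ) = Complex.I * ((n * (2 * Real.pi) : ℝ) : ℂ) := by
      rw [hn]; push_cast; ring
    exact mul_left_cancel₀ Complex.I_ne_zero this
  have hn2 : t = n * (2 * Real.pi) := by exact_mod_cast hn'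
  have hn0 : n ≠ 0 := by
    rintro rfl
    simp at hn2
    rw [hn2] at ht; simp at ht
  have h1n : (1:ℝ) ≤ |(n:ℝ)| := by exact_mod_cast Int.one_le_abs hn0
  rw [hn2, abs_mul, abs_of_pos (by positivity : 0 < 2 * Real.pi)] at htp
  nlinarith [Real.pi_pos]

/-- global bound on the characteristic function -/
lemma psi_bound (H : OffHyp μ) {c : ℝ} (hc : 0 < c)
    (hQ : ∀ t : ℝ, 0 < t → t ≤ 1 → c * hh μ t ≤ QQ μ t) :
    (∃ c1 : ℝ, 0 < c1 ∧ ∀ t : ℝ, |t| ≤ 1 → c1 * hh μ |t| ≤ (1 - psi μ t).re) ∧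
    ∃ c2 : ℝ, 0 < c2 ∧ ∀ t : ℝ, |t| ≤ Real.pi → ‖psi μ t‖ ≤ 1 - c2 * hh μ |t| := by
  set c1 := 2 / Real.pi ^ 2 * c with hc1
  have hpi := Real.pi_pos
  have hc1p : 0 < c1 := by positivity
  have A : ∀ t : ℝ, |t| ≤ 1 → c1 * hh μ |t| ≤ (1 - psi μ t).re := by
    intro t ht
    have h1 := H.re_lower t
    rcases (abs_nonneg t).eq_or_lt with h | h
    · rw [← h, H.hh_zero, mul_zero]
      rw [← h] at h1
      refine le_trans ?_ h1
      have : 0 ≤ QQ μ 0 := tsum_nonneg (H.Qterm_nonneg 0)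
      positivity
    · have h2 := hQ |t| h ht
      have h3 := mul_le_mul_of_nonneg_left h2 (by positivity : 0 ≤ 2 / Real.pi ^ 2)
      rw [hc1, mul_assoc]
      linarith
  refine ⟨⟨c1, hc1p, A⟩, ?_⟩
  set t1 := min 1 (c1 / 8) with ht1
  have ht1p : 0 < t1 := lt_min one_pos (by positivity)
  have ht11 : t1 ≤ 1 := min_le_left _ _
  have B : ∀ t : ℝ, |t| ≤ t1 → ‖psi μ t‖ ≤ 1 - c1 / 2 * hh μ |t| := by
    intro t ht
    have h1 := A t (ht.trans ht11)
    have h2 := H.psi_upper t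
    have h3 := H.hh_le (abs_nonneg t)
    have h4 := H.hh_nonneg (abs_nonneg t)
    have h5 : 4 * hh μ |t| ≤ c1 := by
      have := ht.trans (min_le_right 1 (c1 / 8))
      linarith
    have e : ‖psi μ t‖ ^ 2 = 1 - 2 * (1 - psi μ t).re + ‖1 - psi μ t‖ ^ 2 := by
      rw [Complex.sq_norm, Complex.sq_norm, Complex.normSq_apply, Complex.normSq_apply]
      simp only [Complex.sub_re, Complex.one_re, Complex.sub_im, Complex.one_im]
      ring
    have h6 : ‖1 - psi μ t‖ ^ 2 ≤ (2 * hh μ |t|) ^ 2 := by gcongr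
    have h7 : (2 * hh μ |t|) ^ 2 ≤ c1 * hh μ |t| := by nlinarith
    have h8 : c1 / 2 * hh μ |t| ≤ 1 := by
      have h9 := Complex.re_le_norm (1 - psi μ t)
      have h10 := norm_sub_le (1:ℂ) (psi μ t)
      have h11 := H.psi_norm_le t
      rw [norm_one] at h10
      linarith
    refine abs_le_of_sq_le_sq' ?_ (by linarith) |>.2
    nlinarith [sq_nonneg (c1 * hh μ |t|)]
  obtain ⟨x, hx, hmax⟩ := (isCompact_Icc (a := -Real.pi) (b := Real.pi)).inter_right
    ((isClosed_le continuous_const continuous_abs : IsClosed {t : ℝ | t1 ≤ |t|})) |>.exists_isMaxOn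
    ⟨Real.pi, ⟨by constructor <;> linarith, by
      simp only [Set.mem_ofPred_eq]; rw [abs_of_pos hpi]; linarith [Real.pi_gt_three]⟩⟩
    (H.psi_cont.norm.continuousOn)
  have hx1 : ‖psi μ x‖ < 1 := by
    have h2 : t1 ≤ |x| := hx.2
    exact H.psi_lt (by linarith) (abs_le.2 hx.1)
  set d := 1 - ‖psi μ x‖ with hd
  have hdp : 0 < d := by linarith
  refine ⟨min (c1 / 2) (d / (2 * Real.pi)), lt_min (by positivity) (by positivity), fun t ht => ?_⟩
  have h4 := H.hh_nonneg (abs_nonneg t)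
  rcases le_total |t| t1 with h | h
  · have h1 := B t h
    have := mul_le_mul_of_nonneg_right (min_le_left (c1 / 2) (d / (2 * Real.pi))) h4
    linarith
  · have h1 : ‖psi μ t‖ ≤ ‖psi μ x‖ := hmax ⟨abs_le.1 ht, h⟩
    have h2 := mul_le_mul_of_nonneg_right (min_le_right (c1 / 2) (d / (2 * Real.pi))) h4
    have h3 := H.hh_le (abs_nonneg t)
    have h5 : d / (2 * Real.pi) * hh μ |t| ≤ d := by
      rw [div_mul_eq_mul_div, div_le_iff₀ (by positivity)]
      refine mul_le_mul_of_nonneg_left ?_ hdp.le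
      linarith
    linarith

end OffHyp

/-- law of the centered walk -/
def vv (μ : ℕ → ℝ) (n : ℕ) (x : ℤ) : ℝ := if 0 ≤ (n:ℤ) + x then cA μ n ((n:ℤ) + x).toNat else 0

lemma ee_integral (k : ℤ) : ∫ t in (-Real.pi)..Real.pi, ee (k * t) =
    if k = 0 then (2 * Real.pi : ℂ) else 0 := by
  split_ifs with h
  · subst h
    simp [ee_zero]
    ring
  · have hk : (Complex.I * (k:ℂ)) ≠ 0 := mul_ne_zero Complex.I_ne_zero (by exact_mod_cast h)
    have h1 := integral_exp_mul_complex (a := -Real.pi) (b := Real.pi) hk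
    have h2 : ∀ t : ℝ, ee (k * t) = Complex.exp (Complex.I * k * t) := by
      intro t; unfold ee; push_cast; ring_nf
    simp_rw [h2, h1]
    have h3 : Complex.exp (Complex.I * k * (Real.pi : ℝ)) = Complex.exp (Complex.I * k * ((-Real.pi : ℝ))) := by
      rw [Complex.exp_eq_exp_iff_exists_int]
      exact ⟨k, by push_cast; ring⟩
    rw [h3, sub_self, zero_div]

namespace OffHyp
variable {μ : ℕ → ℝ}

lemma cA_hasSum (H : OffHyp μ) (n : ℕ) : HasSum (cA μ n) 1 := by
  have h := pow_hasSum (oP μ) (by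
    simpa [oP, PowerSeries.coeff_mk] using H.sum.summable.abs) n
  have h2 := h.2
  have e : ∑' m, PowerSeries.coeff m (oP μ) = 1 := by
    simp only [oP, PowerSeries.coeff_mk]; exact H.sum.tsum_eq
  rw [e, one_pow] at h2
  exact h2

lemma psi_pow_hasSum (H : OffHyp μ) (n : ℕ) (t : ℝ) :
    HasSum (fun m : ℕ => (cA μ n m : ℂ) * ee (((m:ℝ) - n) * t)) (psi μ t ^ n) := by
  set P : PowerSeries ℂ := PowerSeries.rescale (ee t) (PowerSeries.map Complex.ofRealHom (oP μ)) with hP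
  have hc : ∀ m, PowerSeries.coeff m P = (μ m : ℂ) * ee (m * t) := by
    intro m
    rw [hP, PowerSeries.coeff_rescale, PowerSeries.coeff_map, oP, PowerSeries.coeff_mk, ee_pow]
    simp [mul_comm]
  have hcn : ∀ m, PowerSeries.coeff m (P ^ n) = (cA μ n m : ℂ) * ee (m * t) := by
    intro m
    rw [hP, ← map_pow, ← map_pow, PowerSeries.coeff_rescale, PowerSeries.coeff_map, ee_pow]
    simp [mul_comm, cA]
  have h := (pow_hasSum P (by
    simp_rw [hc, norm_mul, ee_norm, mul_one, Complex.norm_real]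
    exact H.sum.summable.norm) n).2
  simp_rw [hc, hcn] at h
  have h2 := h.mul_right (ee (-t) ^ n)
  have e1 : (∑' m : ℕ, (μ m : ℂ) * ee (m * t)) ^ n * ee (-t) ^ n = psi μ t ^ n := by
    rw [← mul_pow, ← tsum_mul_right]
    congr 1
    unfold psi
    refine tsum_congr fun j => ?_
    rw [mul_assoc, ← ee_add]
    congr 2; ring
  have e2 : (fun m : ℕ => (cA μ n m : ℂ) * ee (m * t) * ee (-t) ^ n) =
      fun m : ℕ => (cA μ n m : ℂ) * ee (((m:ℝ) - n) * t) := by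
    funext m
    rw [ee_pow, mul_assoc, ← ee_add]
    congr 2; ring
  rw [e1, e2] at h2
  exact h2

lemma inversion (H : OffHyp μ) (n : ℕ) (x : ℤ) :
    ∫ t in (-Real.pi)..Real.pi, psi μ t ^ n * ee (-x * t) = 2 * Real.pi * (vv μ n x : ℂ) := by
  have h1 : HasSum (fun m : ℕ => ∫ t in (-Real.pi)..Real.pi,
      (cA μ n m : ℂ) * ee (((m - n - x : ℤ) : ℝ) * t))
      (∫ t in (-Real.pi)..Real.pi, psi μ t ^ n * ee (-x * t)) := by
    refine intervalIntegral.hasSum_integral_of_dominated_convergence (fun m _ => cA μ n m)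
      (fun m => ?_) (fun m => ?_) ?_ ?_ ?_
    · exact (continuous_const.mul (ee_cont.comp (by fun_prop))).aestronglyMeasurable
    · refine Eventually.of_forall fun t _ => ?_
      rw [norm_mul, ee_norm, mul_one, Complex.norm_real, Real.norm_of_nonneg (cA_nonneg μ H.nn n m)]
    · exact Eventually.of_forall fun t _ => (H.cA_hasSum n).summable
    · exact intervalIntegrable_const
    · refine Eventually.of_forall fun t _ => ?_
      have h2 := (H.psi_pow_hasSum n t).mul_right (ee (-x * t))
      have e2 : (fun m : ℕ => (cA μ n m : ℂ) * ee (((m:ℝ) - n) * t) * ee (-x * t)) =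
          fun m : ℕ => (cA μ n m : ℂ) * ee (((m - n - x : ℤ) : ℝ) * t) := by
        funext m
        rw [mul_assoc, ← ee_add]
        congr 2; push_cast; ring
      rw [e2] at h2
      exact h2
  simp_rw [intervalIntegral.integral_const_mul, ee_integral] at h1
  refine h1.unique ?_
  unfold vv
  split_ifs with h
  · have h2 := hasSum_ite_eq ((n:ℤ) + x).toNat (2 * Real.pi * (cA μ n ((n:ℤ) + x).toNat : ℂ))
    have e : (fun m : ℕ => (cA μ n m : ℂ) * if (m - n - x : ℤ) = 0 then (2 * Real.pi : ℂ) else 0) =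
      fun m : ℕ => if m = ((n:ℤ) + x).toNat then 2 * Real.pi * (cA μ n ((n:ℤ) + x).toNat : ℂ) else 0 := by
      funext m
      by_cases hm : m = ((n:ℤ) + x).toNat
      · have : (m - n - x : ℤ) = 0 := by omega
        rw [if_pos this, if_pos hm, ← hm]; ring
      · have : ¬ (m - n - x : ℤ) = 0 := by omega
        rw [if_neg this, if_neg hm, mul_zero]
    rw [e]
    exact h2
  · have e : (fun m : ℕ => (cA μ n m : ℂ) * if (m - n - x : ℤ) = 0 then (2 * Real.pi : ℂ) else 0) =
      fun m : ℕ => 0 := by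
      funext m
      have : ¬ (m - n - x : ℤ) = 0 := by omega
      rw [if_neg this, mul_zero]
    rw [e]
    simpa using hasSum_zero

lemma vv_nonneg (H : OffHyp μ) (n : ℕ) (x : ℤ) : 0 ≤ vv μ n x := by
  unfold vv
  split_ifs
  · exact cA_nonneg μ H.nn _ _
  · exact le_rfl

/-- Chapman-Kolmogorov inequality -/
lemma vv_conv (H : OffHyp μ) (m n : ℕ) (x : ℤ) (s : Finset ℤ) :
    ∑ y ∈ s, vv μ m y * vv μ n (x - y) ≤ vv μ (m + n) x := by
  have hnn : ∀ y, 0 ≤ vv μ m y * vv μ n (x - y) := fun y => mul_nonneg (H.vv_nonneg _ _) (H.vv_nonneg _ _)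
  have hsub : ∑ y ∈ s, vv μ m y * vv μ n (x - y) =
      ∑ y ∈ s with (0 ≤ (m:ℤ) + y ∧ 0 ≤ (n:ℤ) + (x - y)), vv μ m y * vv μ n (x - y) := by
    rw [Finset.sum_filter]
    refine Finset.sum_congr rfl fun y _ => ?_
    split_ifs with h
    · rfl
    · rw [not_and_or] at h
      unfold vv
      rcases h with h | h <;> rw [if_neg h] <;> simp
  rw [hsub]
  by_cases hx : 0 ≤ ((m + n : ℕ) : ℤ) + x
  · have e : vv μ (m + n) x = cA μ (m + n) (((m + n : ℕ) : ℤ) + x).toNat := by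
      unfold vv; rw [if_pos hx]
    rw [e, cA_add]
    have himg : ∑ y ∈ s with (0 ≤ (m:ℤ) + y ∧ 0 ≤ (n:ℤ) + (x - y)), vv μ m y * vv μ n (x - y) =
        ∑ p ∈ (Finset.image (fun y : ℤ => (((m:ℤ) + y).toNat, ((n:ℤ) + (x - y)).toNat))
          ({y ∈ s | (0 ≤ (m:ℤ) + y ∧ 0 ≤ (n:ℤ) + (x - y))})), cA μ m p.1 * cA μ n p.2 := by
      rw [Finset.sum_image]
      · refine Finset.sum_congr rfl fun y hy => ?_
        have hy' := (Finset.mem_filter.1 hy).2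
        unfold vv
        rw [if_pos hy'.1, if_pos hy'.2]
      · intro y hy z hz hyz
        have hy' := (Finset.mem_filter.1 hy).2
        have hz' := (Finset.mem_filter.1 hz).2
        simp only [Prod.mk.injEq] at hyz
        omega
    rw [himg]
    refine Finset.sum_le_sum_of_subset_of_nonneg ?_ fun p _ _ =>
      mul_nonneg (cA_nonneg μ H.nn _ _) (cA_nonneg μ H.nn _ _)
    intro p hp
    obtain ⟨y, hy, rfl⟩ := Finset.mem_image.1 hp
    have hy' := (Finset.mem_filter.1 hy).2
    rw [Finset.HasAntidiagonal.mem_antidiagonal]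
    push_cast at hx ⊢
    omega
  · have e : (Finset.filter (fun y : ℤ => (0 ≤ (m:ℤ) + y ∧ 0 ≤ (n:ℤ) + (x - y))) s) = ∅ := by
      refine Finset.filter_eq_empty_iff.2 fun y _ => ?_
      push_cast at hx
      omega
    rw [e, Finset.sum_empty]
    exact H.vv_nonneg _ _

end OffHyp

lemma int_exp_le {b : ℝ} (hb : 0 < b) : ∫ t in (-Real.pi)..Real.pi, Real.exp (-b * |t|) ≤ 2 / b := by
  have hpi := Real.pi_pos
  have hci : ∀ u v : ℝ, IntervalIntegrable (fun t : ℝ => Real.exp (-b * |t|)) MeasureTheory.volume u v :=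
    fun u v => Continuous.intervalIntegrable (by fun_prop) u v
  have h1 : ∫ t in (0:ℝ)..Real.pi, Real.exp (-b * |t|) ≤ 1 / b := by
    have e : ∫ t in (0:ℝ)..Real.pi, Real.exp (-b * |t|) = ∫ t in (0:ℝ)..Real.pi, Real.exp (-b * t) := by
      refine intervalIntegral.integral_congr fun t ht => ?_
      rw [uIcc_of_le hpi.le] at ht
      simp only [abs_of_nonneg ht.1]
    have e2 : ∫ t in (0:ℝ)..Real.pi, Real.exp (-b * t) =
        (-(1 / b) * Real.exp (-b * Real.pi)) - (-(1 / b) * Real.exp (-b * 0)) := by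
      refine intervalIntegral.integral_eq_sub_of_hasDerivAt (f := fun t => -(1 / b) * Real.exp (-b * t)) (fun t _ => ?_)
        (Continuous.intervalIntegrable (by fun_prop) _ _)
      have h3 : HasDerivAt (fun t : ℝ => -b * t) (-b) t := by
        simpa using (hasDerivAt_id t).const_mul (-b)
      have h4 := (h3.exp).const_mul (-(1 / b))
      have h5 : -(1 / b) * (Real.exp (-b * t) * -b) = Real.exp (-b * t) := by field_simp
      rw [h5] at h4
      exact h4
    rw [e, e2]
    have : 0 < 1 / b * Real.exp (-b * Real.pi) := by positivity
    simp only [mul_zero, Real.exp_zero]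
    linarith
  have h2 : ∫ t in (-Real.pi)..(0:ℝ), Real.exp (-b * |t|) = ∫ t in (0:ℝ)..Real.pi, Real.exp (-b * |t|) := by
    have := intervalIntegral.integral_comp_neg (fun t : ℝ => Real.exp (-b * |t|)) (a := 0) (b := Real.pi)
    simp only [abs_neg, neg_zero] at this
    exact this.symm
  rw [← intervalIntegral.integral_add_adjacent_intervals (hci (-Real.pi) 0) (hci 0 Real.pi), h2]
  have : 2 / b = 1 / b + 1 / b := by ring
  linarith

lemma int_bound {F : ℝ → ℂ} {B b : ℝ} (hb : 0 < b) (hB : 0 ≤ B)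
    (h : ∀ t, |t| ≤ Real.pi → ‖F t‖ ≤ B * Real.exp (-b * |t|)) :
    ‖∫ t in (-Real.pi)..Real.pi, F t‖ ≤ 2 * B / b := by
  have hpi := Real.pi_pos
  have h1 := intervalIntegral.norm_integral_le_of_norm_le (a := -Real.pi) (b := Real.pi) (f := F)
    (μ := MeasureTheory.volume) (g := fun t => B * Real.exp (-b * |t|)) (by linarith)
    (Eventually.of_forall fun t ht => h t (abs_le.2 ⟨ht.1.le, ht.2⟩))
    (Continuous.intervalIntegrable (by fun_prop) _ _)
  rw [intervalIntegral.integral_const_mul] at h1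
  have h2 := mul_le_mul_of_nonneg_left (int_exp_le hb) hB
  have e : 2 * B / b = B * (2 / b) := by ring
  linarith

lemma le_exp_half (u : ℝ) : u ≤ Real.exp u := by linarith [Real.add_one_le_exp u]

namespace OffHyp
variable {μ a : ℕ → ℝ}

lemma abs_le_of_inv (r : ℝ) {z : ℂ} {M : ℝ} (h : z = 2 * Real.pi * (r : ℂ)) (hz : ‖z‖ ≤ M) : |r| ≤ M := by
  have : ‖z‖ = 2 * Real.pi * |r| := by
    rw [h, norm_mul, norm_mul, Complex.norm_real, Complex.norm_real, Real.norm_of_nonneg Real.pi_pos.le]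
    simp
  nlinarith [Real.pi_gt_three, abs_nonneg r]

lemma psi_pow_le (H : OffHyp μ) {c : ℝ}
    (hψ : ∀ t : ℝ, |t| ≤ Real.pi → ‖psi μ t‖ ≤ 1 - c * hh μ |t|) (n : ℕ) (t : ℝ) (ht : |t| ≤ Real.pi) :
    ‖psi μ t‖ ^ n ≤ Real.exp (-(c * (n * hh μ |t|))) := by
  have h1 : ‖psi μ t‖ ≤ Real.exp (-(c * hh μ |t|)) := by
    have := Real.add_one_le_exp (-(c * hh μ |t|))
    linarith [hψ t ht]
  calc ‖psi μ t‖ ^ n ≤ (Real.exp (-(c * hh μ |t|))) ^ n := by gcongr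
    _ = _ := by rw [← Real.exp_nat_mul]; congr 1; ring

lemma vv_bounds (H : OffHyp μ) (S : SeqA μ a) {c : ℝ} (hc : 0 < c)
    (hψ : ∀ t : ℝ, |t| ≤ Real.pi → ‖psi μ t‖ ≤ 1 - c * hh μ |t|) :
    ∃ C : ℝ, 0 < C ∧ (∀ n, 1 ≤ n → ∀ x, vv μ n x ≤ C * a n) ∧
      (∀ n, 1 ≤ n → ∀ x, |vv μ n x - vv μ n 0| ≤ C * |(x:ℝ)| * a n ^ 2) ∧
      (∀ n, 1 ≤ n → ∀ x, |vv μ (n + 1) x - vv μ n x| ≤ C * (a n / n)) := by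
  set C := 2 * Real.exp c / c + 8 * Real.exp c / c ^ 2 + 16 * Real.exp (c / 2) / c ^ 2 with hC
  have hC1 : 0 < 2 * Real.exp c / c := by positivity
  have hC2 : 0 < 8 * Real.exp c / c ^ 2 := by positivity
  have hC3 : 0 < 16 * Real.exp (c / 2) / c ^ 2 := by positivity
  have hcont := H.psi_cont
  have hii : ∀ (n : ℕ) (x : ℤ), IntervalIntegrable (fun t => psi μ t ^ n * ee (-x * t))
      MeasureTheory.volume (-Real.pi) Real.pi := by
    intro n x
    refine Continuous.intervalIntegrable ?_ _ _
    exact (hcont.pow n).mul (ee_cont.comp (by fun_prop))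
  -- exponential bound
  have hexp : ∀ n : ℕ, 1 ≤ n → ∀ d : ℝ, 0 < d → ∀ t : ℝ, Real.exp (-(d * (n * hh μ |t|))) ≤
      Real.exp d * Real.exp (-(d / a n) * |t|) := by
    intro n hn d hd t
    rw [← Real.exp_add]
    refine Real.exp_le_exp.2 ?_
    have := mul_le_mul_of_nonneg_left (S.lin H hn (abs_nonneg t)) hd.le
    have e : d + -(d / a n) * |t| = - (d * (|t| / a n - 1)) := by ring
    linarith
  refine ⟨C, by positivity, fun n hn x => ?_, fun n hn x => ?_, fun n hn x => ?_⟩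
  · have hp := S.pos n hn
    have h1 := abs_le_of_inv (vv μ n x) (H.inversion n x) (int_bound (B := Real.exp c) (b := c / a n)
      (by positivity) (by positivity) (fun t ht => by
        rw [norm_mul, ee_norm, mul_one, norm_pow]
        exact (H.psi_pow_le hψ n t ht).trans (hexp n hn c hc t)))
    refine (le_abs_self _).trans (h1.trans ?_)
    have e : 2 * Real.exp c / (c / a n) = 2 * Real.exp c / c * a n := by field_simp
    rw [e]
    refine mul_le_mul_of_nonneg_right ?_ hp.le
    linarith
  · have hp := S.pos n hn
    have hz : (∫ t in (-Real.pi)..Real.pi, (psi μ t ^ n * ee (-x * t) - psi μ t ^ n * ee (-((0:ℤ):ℝ) * t))) =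
        2 * Real.pi * ((vv μ n x - vv μ n 0 : ℝ) : ℂ) := by
      rw [intervalIntegral.integral_sub (hii n x) (hii n 0), H.inversion, H.inversion]
      push_cast; ring
    have h1 := abs_le_of_inv _ hz (int_bound (B := Real.exp c * |(x:ℝ)| * (2 * a n / c)) (b := c / (2 * a n))
      (by positivity) (by positivity) (fun t ht => by
        have e1 : psi μ t ^ n * ee (-x * t) - psi μ t ^ n * ee (-((0:ℤ):ℝ) * t) =
            psi μ t ^ n * (ee (-x * t) - 1) := by
          have : ee (-((0:ℤ):ℝ) * t) = 1 := by simp [ee_zero]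
          rw [this]; ring
        rw [e1, norm_mul, norm_pow]
        have h2 := (H.psi_pow_le hψ n t ht).trans (hexp n hn c hc t)
        have h3 := ee_sub_le (-x * t)
        rw [abs_mul, abs_neg] at h3
        have h4 : |t| ≤ 2 * a n / c * Real.exp (c / (2 * a n) * |t|) := by
          have h5 := le_exp_half (c / (2 * a n) * |t|)
          calc |t| = 2 * a n / c * (c / (2 * a n) * |t|) := by field_simp
            _ ≤ _ := mul_le_mul_of_nonneg_left h5 (by positivity)
        calc ‖psi μ t‖ ^ n * ‖ee (-x * t) - 1‖
            ≤ (Real.exp c * Real.exp (-(c / a n) * |t|)) *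
              (|(x:ℝ)| * (2 * a n / c * Real.exp (c / (2 * a n) * |t|))) := by
              refine mul_le_mul h2 (h3.trans ?_) (norm_nonneg _) (by positivity)
              exact mul_le_mul_of_nonneg_left h4 (abs_nonneg _)
          _ = Real.exp c * |(x:ℝ)| * (2 * a n / c) *
              (Real.exp (-(c / a n) * |t|) * Real.exp (c / (2 * a n) * |t|)) := by ring
          _ = _ := by
              rw [← Real.exp_add]
              congr 2
              field_simp
              ring))
    refine h1.trans ?_
    have e : 2 * (Real.exp c * |(x:ℝ)| * (2 * a n / c)) / (c / (2 * a n)) =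
        8 * Real.exp c / c ^ 2 * (|(x:ℝ)| * a n ^ 2) := by field_simp; ring
    rw [e, mul_assoc C]
    refine mul_le_mul_of_nonneg_right ?_ (by positivity)
    linarith
  · have hp := S.pos n hn
    have hn0 : (0:ℝ) < n := by positivity
    have hz : (∫ t in (-Real.pi)..Real.pi, (psi μ t ^ (n + 1) * ee (-x * t) - psi μ t ^ n * ee (-x * t))) =
        2 * Real.pi * ((vv μ (n + 1) x - vv μ n x : ℝ) : ℂ) := by
      rw [intervalIntegral.integral_sub (hii _ x) (hii n x), H.inversion, H.inversion]
      push_cast; ring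
    have h1 := abs_le_of_inv _ hz (int_bound (B := 4 / (c * n) * Real.exp (c / 2)) (b := c / 2 / a n)
      (by positivity) (by positivity) (fun t ht => by
        have e1 : psi μ t ^ (n + 1) * ee (-x * t) - psi μ t ^ n * ee (-x * t) =
            - (psi μ t ^ n * (1 - psi μ t) * ee (-x * t)) := by ring
        rw [e1, norm_neg, norm_mul, norm_mul, norm_pow, ee_norm, mul_one]
        have h2 := H.psi_pow_le hψ n t ht
        have h3 := H.psi_upper t
        have h4 : 2 * hh μ |t| ≤ 4 / (c * n) * Real.exp (c / 2 * (n * hh μ |t|)) := by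
          have h5 := le_exp_half (c / 2 * (n * hh μ |t|))
          calc 2 * hh μ |t| = 4 / (c * n) * (c / 2 * (n * hh μ |t|)) := by field_simp; ring
            _ ≤ _ := mul_le_mul_of_nonneg_left h5 (by positivity)
        calc ‖psi μ t‖ ^ n * ‖1 - psi μ t‖
            ≤ Real.exp (-(c * (n * hh μ |t|))) * (4 / (c * n) * Real.exp (c / 2 * (n * hh μ |t|))) :=
              mul_le_mul h2 (h3.trans h4) (norm_nonneg _) (by positivity)
          _ = 4 / (c * n) * (Real.exp (-(c * (n * hh μ |t|))) * Real.exp (c / 2 * (n * hh μ |t|))) := by ring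
          _ = 4 / (c * n) * Real.exp (-(c / 2 * (n * hh μ |t|))) := by
              rw [← Real.exp_add]; congr 2; ring
          _ ≤ 4 / (c * n) * (Real.exp (c / 2) * Real.exp (-(c / 2 / a n) * |t|)) :=
              mul_le_mul_of_nonneg_left (hexp n hn (c / 2) (by positivity) t) (by positivity)
          _ = _ := by ring))
    refine h1.trans ?_
    have e : 2 * (4 / (c * n) * Real.exp (c / 2)) / (c / 2 / a n) =
        16 * Real.exp (c / 2) / c ^ 2 * (a n / n) := by field_simp; ring
    rw [e]
    refine mul_le_mul_of_nonneg_right ?_ (by positivity)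
    linarith

end OffHyp

namespace OffHyp
variable {μ a : ℕ → ℝ}

lemma abel_hasSum (H : OffHyp μ) {s : ℝ} (hs0 : 0 ≤ s) (hs1 : s < 1) :
    HasSum (fun j => 2 * Real.pi * (s ^ j * vv μ j 0))
      (∫ t in (-Real.pi)..Real.pi, ((1 - s * psi μ t)⁻¹).re) := by
  have hnorm : ∀ t, ‖(s:ℂ) * psi μ t‖ ≤ s := by
    intro t
    rw [norm_mul, Complex.norm_real, Real.norm_of_nonneg hs0]
    exact mul_le_of_le_one_right hs0 (H.psi_norm_le t)
  have hne : ∀ t, 1 - (s:ℂ) * psi μ t ≠ 0 := by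
    intro t h0
    have := hnorm t
    rw [← sub_eq_zero.1 h0, norm_one] at this
    linarith
  have h1 : HasSum (fun j : ℕ => ∫ t in (-Real.pi)..Real.pi, ((s:ℂ) * psi μ t) ^ j)
      (∫ t in (-Real.pi)..Real.pi, (1 - s * psi μ t)⁻¹) := by
    refine intervalIntegral.hasSum_integral_of_dominated_convergence (fun j _ => s ^ j)
      (fun j => ?_) (fun j => ?_) ?_ ?_ ?_
    · exact ((continuous_const.mul H.psi_cont).pow j).aestronglyMeasurable
    · refine Eventually.of_forall fun t _ => ?_
      rw [norm_pow]
      gcongr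
      exact hnorm t
    · exact Eventually.of_forall fun t _ => summable_geometric_of_lt_one hs0 hs1
    · exact intervalIntegrable_const
    · refine Eventually.of_forall fun t _ => ?_
      exact hasSum_geometric_of_norm_lt_one ((hnorm t).trans_lt hs1)
  have h2 : ∀ j : ℕ, ∫ t in (-Real.pi)..Real.pi, ((s:ℂ) * psi μ t) ^ j =
      ((2 * Real.pi * (s ^ j * vv μ j 0) : ℝ) : ℂ) := by
    intro j
    have h3 := H.inversion j 0
    have h4 : ∀ t : ℝ, ((s:ℂ) * psi μ t) ^ j = (s:ℂ) ^ j * (psi μ t ^ j * ee (-((0:ℤ):ℝ) * t)) := by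
      intro t
      have : ee (-((0:ℤ):ℝ) * t) = 1 := by simp [ee_zero]
      rw [this, mul_one, mul_pow]
    simp_rw [h4]
    rw [intervalIntegral.integral_const_mul, h3]
    push_cast; ring
  simp_rw [h2] at h1
  have h5 := Complex.hasSum_re h1
  simp only [Complex.ofReal_re] at h5
  have hIntg : IntervalIntegrable (fun t => (1 - (s:ℂ) * psi μ t)⁻¹) MeasureTheory.volume (-Real.pi) Real.pi := by
    refine Continuous.intervalIntegrable ?_ _ _
    exact (continuous_const.sub (continuous_const.mul H.psi_cont)).inv₀ hne
  have h6 := Complex.reCLM.intervalIntegral_comp_comm hIntg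
  simp only [Complex.reCLM_apply] at h6
  rw [← h6] at h5
  exact h5

lemma abel_lower (H : OffHyp μ) (S : SeqA μ a) {n : ℕ} (hn : 2 ≤ n) (ha : a n ≤ 1) :
    Summable (fun j => (1 - 1 / (n:ℝ)) ^ j * vv μ j 0) ∧
    n * a n / 36 ≤ ∑' j, (1 - 1 / (n:ℝ)) ^ j * vv μ j 0 := by
  have hpi := Real.pi_pos
  have hn0 : (0:ℝ) < n := by positivity
  set s : ℝ := 1 - 1 / n with hs
  have hinv : 0 < 1 / (n:ℝ) := by positivity
  have hs1 : s < 1 := by linarith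
  have hs0 : 0 ≤ s := by
    have : (1:ℝ) / n ≤ 1 := by
      rw [div_le_one hn0]; exact_mod_cast (by omega : 1 ≤ n)
    linarith
  have h1 := H.abel_hasSum hs0 hs1
  have hp := S.pos n (by omega)
  have hnorm : ∀ t, ‖(s:ℂ) * psi μ t‖ ≤ s := by
    intro t
    rw [norm_mul, Complex.norm_real, Real.norm_of_nonneg hs0]
    exact mul_le_of_le_one_right hs0 (H.psi_norm_le t)
  have hne : ∀ t, 1 - (s:ℂ) * psi μ t ≠ 0 := by
    intro t h0
    have := hnorm t
    rw [← sub_eq_zero.1 h0, norm_one] at this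
    linarith
  have hre : ∀ t, 1 / (n:ℝ) ≤ (1 - (s:ℂ) * psi μ t).re := by
    intro t
    have h2 := (Complex.re_le_norm ((s:ℂ) * psi μ t)).trans (hnorm t)
    rw [Complex.sub_re, Complex.one_re]
    linarith
  have hcont : Continuous fun t => ((1 - (s:ℂ) * psi μ t)⁻¹).re :=
    Complex.continuous_re.comp ((continuous_const.sub (continuous_const.mul H.psi_cont)).inv₀ hne)
  have hnn : ∀ t, 0 ≤ ((1 - (s:ℂ) * psi μ t)⁻¹).re := by
    intro t
    rw [Complex.inv_re]
    exact div_nonneg (hinv.le.trans (hre t)) (Complex.normSq_nonneg _)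
  have hlow : ∀ t ∈ Icc (-a n) (a n), (n:ℝ) / 9 ≤ ((1 - (s:ℂ) * psi μ t)⁻¹).re := by
    intro t ht
    have ht' : |t| ≤ a n := abs_le.2 ht
    have h2 := H.hh_mono (abs_nonneg t) ht'
    rw [S.eq n (by omega)] at h2
    have h3 := H.psi_upper t
    have e : 1 - (s:ℂ) * psi μ t = (1 - psi μ t) + ((1 / (n:ℝ) : ℝ) : ℂ) * psi μ t := by
      rw [hs]; push_cast; ring
    have h4 : ‖1 - (s:ℂ) * psi μ t‖ ≤ 3 * (1 / (n:ℝ)) := by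
      rw [e]
      refine (norm_add_le _ _).trans ?_
      rw [norm_mul, Complex.norm_real, Real.norm_of_nonneg hinv.le]
      have := mul_le_of_le_one_right hinv.le (H.psi_norm_le t)
      linarith
    rw [Complex.inv_re, ← Complex.sq_norm]
    have hnp : 0 < ‖1 - (s:ℂ) * psi μ t‖ := norm_pos_iff.2 (hne t)
    rw [le_div_iff₀ (by positivity)]
    calc (n:ℝ) / 9 * ‖1 - (s:ℂ) * psi μ t‖ ^ 2 ≤ (n:ℝ) / 9 * (3 * (1 / (n:ℝ))) ^ 2 := by gcongr
      _ = 1 / (n:ℝ) := by field_simp; ring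
      _ ≤ _ := hre t
  have h2 : ∫ t in (-a n)..(a n), ((1 - (s:ℂ) * psi μ t)⁻¹).re ≤
      ∫ t in (-Real.pi)..Real.pi, ((1 - (s:ℂ) * psi μ t)⁻¹).re := by
    refine intervalIntegral.integral_mono_interval ?_ (by linarith) ?_
      (Eventually.of_forall hnn) (hcont.intervalIntegrable _ _)
    · linarith [Real.pi_gt_three]
    · linarith [Real.pi_gt_three]
  have h3 := intervalIntegral.integral_mono_on (a := -a n) (b := a n) (μ := MeasureTheory.volume) (by linarith)
    (intervalIntegrable_const (c := (n:ℝ) / 9)) (hcont.intervalIntegrable _ _) hlow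
  rw [intervalIntegral.integral_const, smul_eq_mul] at h3
  have h4 : HasSum (fun j => s ^ j * vv μ j 0)
      ((2 * Real.pi)⁻¹ * ∫ t in (-Real.pi)..Real.pi, ((1 - (s:ℂ) * psi μ t)⁻¹).re) := by
    have h5 := h1.mul_left (2 * Real.pi)⁻¹
    have e : (fun j => (2 * Real.pi)⁻¹ * (2 * Real.pi * (s ^ j * vv μ j 0))) =
        fun j => s ^ j * vv μ j 0 := by
      funext j; field_simp
    rw [e] at h5
    exact h5
  refine ⟨h4.summable, ?_⟩
  rw [h4.tsum_eq, ← div_eq_inv_mul, le_div_iff₀ (by positivity)]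
  refine le_trans ?_ (h3.trans h2)
  have : Real.pi ≤ 4 := Real.pi_le_four
  have hna : 0 < n * a n := by positivity
  nlinarith

end OffHyp

lemma sum_rpow_le {β : ℝ} (h0 : 0 < β) (h1 : β < 1) (L : ℕ) :
    ∑ j ∈ Finset.Icc 1 L, ((j:ℝ)) ^ (-β) ≤ (L:ℝ) ^ (1 - β) / (1 - β) := by
  have hb : 0 < 1 - β := by linarith
  induction L with
  | zero => simp; positivity
  | succ L ih =>
    rw [Finset.sum_Icc_succ_top (by omega)]
    have hx : (0:ℝ) < ((L + 1 : ℕ) : ℝ) := by positivity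
    have hB := rpow_one_add_le_one_add_mul_self (s := -1 / ((L + 1 : ℕ) : ℝ)) (p := 1 - β) (by
      rw [le_div_iff₀ hx]; push_cast; linarith [(Nat.cast_nonneg L : (0:ℝ) ≤ L)]) hb.le (by linarith)
    have e1 : 1 + -1 / ((L + 1 : ℕ) : ℝ) = L / ((L + 1 : ℕ) : ℝ) := by push_cast; field_simp; ring
    rw [e1, Real.div_rpow (by positivity) hx.le] at hB
    have hp : 0 < ((L + 1 : ℕ) : ℝ) ^ (1 - β) := by positivity
    rw [div_le_iff₀ hp] at hB
    have e2 : ((L + 1 : ℕ) : ℝ) ^ (1 - β) = ((L + 1 : ℕ) : ℝ) ^ (-β) * ((L + 1 : ℕ) : ℝ) := by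
      rw [← Real.rpow_add_one hx.ne']; congr 1; ring
    have e3 : (1 + (1 - β) * (-1 / ((L + 1 : ℕ) : ℝ))) * ((L + 1 : ℕ) : ℝ) ^ (1 - β) =
        ((L + 1 : ℕ) : ℝ) ^ (1 - β) - (1 - β) * ((L + 1 : ℕ) : ℝ) ^ (-β) := by
      have : (1 - β) * (-1 / ((L + 1 : ℕ) : ℝ)) * ((L + 1 : ℕ) : ℝ) ^ (1 - β) =
          - ((1 - β) * ((L + 1 : ℕ) : ℝ) ^ (-β)) := by
        rw [e2]; field_simp
      rw [add_mul, one_mul, this]; ring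
    rw [e3] at hB
    rw [le_div_iff₀ hb] at ih ⊢
    linarith

namespace OffHyp
variable {μ a : ℕ → ℝ}

lemma exists_good (H : OffHyp μ) (S : SeqA μ a) {C : ℝ} (hC : 0 < C)
    (hv : ∀ n, 1 ≤ n → ∀ x, vv μ n x ≤ C * a n)
    {β C' : ℝ} (hβ0 : 0 < β) (hβ1 : β < 1) (hC' : 0 < C')
    (hpow : ∀ j n : ℕ, 1 ≤ j → j ≤ n → a j ≤ C' * ((n:ℝ) / j) ^ β * a n) :
    ∃ (δ c : ℝ) (K n1 : ℕ), 0 < δ ∧ δ ≤ 1 ∧ 0 < c ∧ 1 ≤ K ∧ ∀ n, n1 ≤ n →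
      ∃ j : ℕ, 1 ≤ j ∧ δ * n ≤ j ∧ j ≤ K * n ∧ c * a n ≤ vv μ j 0 := by
  have hb : 0 < 1 - β := by linarith
  obtain ⟨K, hK⟩ := exists_nat_gt (144 * C)
  have hKp : (0:ℝ) < K := by linarith
  have hK1 : 1 ≤ K := by
    have : (0:ℝ) < K := hKp
    exact_mod_cast this
  set D := C * C' / (1 - β) with hD
  have hDp : 0 < D := by positivity
  set δ := min 1 ((1 / (144 * D)) ^ (1 / (1 - β))) with hδ
  have hδp : 0 < δ := lt_min one_pos (by positivity)
  have hδ1 : δ ≤ 1 := min_le_left _ _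
  have hδD : D * δ ^ (1 - β) ≤ 1 / 144 := by
    have h1 : δ ^ (1 - β) ≤ 1 / (144 * D) := by
      have := Real.rpow_le_rpow hδp.le (min_le_right 1 ((1 / (144 * D)) ^ (1 / (1 - β)))) hb.le
      rw [← Real.rpow_mul (by positivity), one_div_mul_cancel hb.ne', Real.rpow_one] at this
      exact this
    calc D * δ ^ (1 - β) ≤ D * (1 / (144 * D)) := by gcongr
      _ = 1 / 144 := by field_simp
  set c := 1 / (144 * (K:ℝ)) with hc
  have hcp : 0 < c := by positivity
  -- n a_n is eventually large
  have ha1 := S.pos 1 le_rfl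
  have hlarge : ∀ᶠ n : ℕ in atTop, 144 < n * a n := by
    have h1 : Tendsto (fun n : ℕ => (n:ℝ) ^ (1 - β)) atTop atTop :=
      (tendsto_rpow_atTop hb).comp tendsto_natCast_atTop_atTop
    filter_upwards [h1.eventually_gt_atTop (144 * C' / a 1), eventually_ge_atTop 1] with n hn hn1
    have h2 := hpow 1 n le_rfl hn1
    have hn0 : (0:ℝ) < n := by positivity
    rw [Nat.cast_one, div_one] at h2
    rw [div_lt_iff₀ ha1] at hn
    have h3 : (n:ℝ) ^ (1 - β) * (n:ℝ) ^ β = n := by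
      rw [← Real.rpow_add hn0]; simp
    have h4 := mul_le_mul_of_nonneg_left h2 (by positivity : 0 ≤ (n:ℝ) ^ (1 - β))
    have h5 : (n:ℝ) ^ (1 - β) * (C' * (n:ℝ) ^ β * a n) = C' * (n * a n) := by
      calc _ = C' * ((n:ℝ) ^ (1 - β) * (n:ℝ) ^ β * a n) := by ring
        _ = _ := by rw [h3]
    rw [h5] at h4
    have h6 : C' * 144 < C' * (n * a n) := by linarith
    exact lt_of_mul_lt_mul_left h6 hC'.le
  have hsmall : ∀ᶠ n : ℕ in atTop, a n < 1 := (S.tendsto H).eventually_lt_const one_pos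
  obtain ⟨n1, hn1⟩ := eventually_atTop.1 ((hlarge.and hsmall).and (eventually_ge_atTop 2))
  refine ⟨δ, c, K, n1, hδp, hδ1, hcp, hK1, fun n hn => ?_⟩
  obtain ⟨⟨hna, ha⟩, hn2⟩ := hn1 n hn
  have hp := S.pos n (by omega)
  have hn0 : (0:ℝ) < n := by positivity
  obtain ⟨hsum, hlow⟩ := H.abel_lower S hn2 ha.le
  by_contra hcon
  push Not at hcon
  set s : ℝ := 1 - 1 / n with hs
  have hinv : 0 < 1 / (n:ℝ) := by positivity
  have hs1 : s < 1 := by linarith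
  have hs0 : 0 ≤ s := by
    have : (1:ℝ) / n ≤ 1 := by
      rw [div_le_one hn0]; exact_mod_cast (by omega : 1 ≤ n)
    linarith
  rw [← hsum.sum_add_tsum_nat_add (K * n)] at hlow
  -- tail
  have htail : ∑' j, s ^ (j + K * n) * vv μ (j + K * n) 0 ≤ n * a n / 144 := by
    have hKn : n ≤ K * n := Nat.le_mul_of_pos_left n (by omega)
    have hg := (hasSum_geometric_of_lt_one hs0 hs1).mul_left (C * a n * s ^ (K * n))
    have h1 : ∑' j, s ^ (j + K * n) * vv μ (j + K * n) 0 ≤ C * a n * s ^ (K * n) * (1 - s)⁻¹ := by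
      rw [← hg.tsum_eq]
      refine ((summable_nat_add_iff (K * n)).2 hsum).tsum_le_tsum (fun j => ?_) hg.summable
      have h2 := (hv (j + K * n) (by omega) 0).trans
        (mul_le_mul_of_nonneg_left (S.anti H (m := n) (n := j + K * n) (by omega) (by omega)) hC.le)
      have h3 := mul_le_mul_of_nonneg_left h2 (by positivity : 0 ≤ s ^ (j + K * n))
      have e : s ^ (j + K * n) * (C * a n) = C * a n * s ^ (K * n) * s ^ j := by rw [pow_add]; ring
      linarith
    have h2 : s ^ (K * n) ≤ 1 / K := by
      have h3 : s ≤ Real.exp (-(1 / n)) := by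
        have := Real.add_one_le_exp (-(1 / (n:ℝ)))
        linarith
      have h4 : s ^ (K * n) ≤ Real.exp (-(1 / n)) ^ (K * n) := by gcongr
      rw [← Real.exp_nat_mul] at h4
      have e : ((K * n : ℕ) : ℝ) * -(1 / (n:ℝ)) = -K := by push_cast; field_simp
      rw [e, Real.exp_neg] at h4
      refine h4.trans ?_
      rw [← one_div]
      exact one_div_le_one_div_of_le hKp (by linarith [Real.add_one_le_exp (K:ℝ)])
    have e : (1 - s)⁻¹ = n := by rw [hs]; simp
    rw [e] at h1
    refine h1.trans ?_
    calc C * a n * s ^ (K * n) * n ≤ C * a n * (1 / K) * n := by gcongr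
      _ = C / K * (n * a n) := by ring
      _ ≤ 1 / 144 * (n * a n) := by
          refine mul_le_mul_of_nonneg_right ?_ (by positivity)
          rw [div_le_div_iff₀ hKp (by norm_num)]
          linarith
      _ = _ := by ring
  set L := ⌊δ * n⌋₊ with hL
  have hLle : (L:ℝ) ≤ δ * n := Nat.floor_le (by positivity)
  have hLn : L ≤ n := by
    have : (L:ℝ) ≤ n := by nlinarith
    exact_mod_cast this
  have hhead : ∑ j ∈ Finset.range (K * n), s ^ j * vv μ j 0 ≤
      1 + n * a n / 144 + n * a n / 144 := by
    have hpt : ∀ j ∈ Finset.range (K * n), s ^ j * vv μ j 0 ≤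
        (if j = 0 then 1 else 0) + (if j ∈ Finset.Icc 1 L then C * C' * a n * (n:ℝ) ^ β * (j:ℝ) ^ (-β) else 0)
          + c * a n := by
      intro j hj
      rw [Finset.mem_range] at hj
      have hcn : 0 ≤ c * a n := by positivity
      by_cases hj0 : j = 0
      · subst hj0
        have : vv μ 0 0 = 1 := by simp [vv, cA]
        simp [this]
        exact hcn
      · rw [if_neg hj0]
        have h1 : s ^ j * vv μ j 0 ≤ vv μ j 0 :=
          mul_le_of_le_one_left (H.vv_nonneg _ _) (pow_le_one₀ hs0 hs1.le)
        by_cases hjL : j ∈ Finset.Icc 1 L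
        · rw [if_pos hjL]
          rw [Finset.mem_Icc] at hjL
          have hjp : (0:ℝ) < j := by exact_mod_cast hjL.1
          have h2 := hv j hjL.1 0
          have h3 := mul_le_mul_of_nonneg_left (hpow j n hjL.1 (hjL.2.trans hLn)) hC.le
          have e : C * (C' * ((n:ℝ) / j) ^ β * a n) = C * C' * a n * (n:ℝ) ^ β * (j:ℝ) ^ (-β) := by
            rw [Real.div_rpow hn0.le hjp.le, Real.rpow_neg hjp.le]; field_simp
          linarith
        · rw [if_neg hjL]
          rw [Finset.mem_Icc] at hjL
          have h2 : L < j := by omega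
          have h3 := hcon j (by omega) (Nat.lt_of_floor_lt h2).le hj.le
          linarith
    refine (Finset.sum_le_sum hpt).trans ?_
    rw [Finset.sum_add_distrib, Finset.sum_add_distrib, Finset.sum_const, Finset.card_range, nsmul_eq_mul]
    have A : ∑ j ∈ Finset.range (K * n), (if j = 0 then (1:ℝ) else 0) ≤ 1 := by
      rw [Finset.sum_ite_eq']
      split_ifs <;> norm_num
    have B : ∑ j ∈ Finset.range (K * n),
        (if j ∈ Finset.Icc 1 L then C * C' * a n * (n:ℝ) ^ β * (j:ℝ) ^ (-β) else 0) ≤ n * a n / 144 := by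
      have h1 : ∑ j ∈ Finset.range (K * n),
          (if j ∈ Finset.Icc 1 L then C * C' * a n * (n:ℝ) ^ β * (j:ℝ) ^ (-β) else 0) ≤
          ∑ j ∈ Finset.Icc 1 L, C * C' * a n * (n:ℝ) ^ β * (j:ℝ) ^ (-β) := by
        rw [← Finset.sum_filter]
        refine Finset.sum_le_sum_of_subset_of_nonneg ?_ fun j _ _ => by positivity
        intro j hj
        exact (Finset.mem_filter.1 hj).2
      rw [← Finset.mul_sum] at h1
      have h2 := sum_rpow_le hβ0 hβ1 L
      have h3 : (L:ℝ) ^ (1 - β) ≤ δ ^ (1 - β) * (n:ℝ) ^ (1 - β) := by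
        rw [← Real.mul_rpow hδp.le hn0.le]
        exact Real.rpow_le_rpow (by positivity) hLle hb.le
      have h4 : (n:ℝ) ^ (1 - β) * (n:ℝ) ^ β = n := by
        rw [← Real.rpow_add hn0]; simp
      calc _ ≤ _ := h1
        _ ≤ C * C' * a n * (n:ℝ) ^ β * ((δ ^ (1 - β) * (n:ℝ) ^ (1 - β)) / (1 - β)) := by
            refine mul_le_mul_of_nonneg_left (h2.trans ?_) (by positivity)
            gcongr
        _ = D * δ ^ (1 - β) * (((n:ℝ) ^ (1 - β) * (n:ℝ) ^ β) * a n) := by rw [hD]; field_simp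
        _ = D * δ ^ (1 - β) * (n * a n) := by rw [h4]
        _ ≤ 1 / 144 * (n * a n) := mul_le_mul_of_nonneg_right hδD (by positivity)
        _ = _ := by ring
    have E : ((K * n : ℕ) : ℝ) * (c * a n) = n * a n / 144 := by
      rw [hc]; push_cast; field_simp
    linarith
  linarith

end OffHyp

lemma OffHyp.good_step {μ : ℕ → ℝ} (H : OffHyp μ) {b ε c c4 : ℝ} (hb : 0 < b)
    (hc : 0 ≤ c) (hc4 : 0 ≤ c4) (hε : 0 < ε) {m i : ℕ}
    (hm : ∀ x : ℤ, |(x:ℝ)| * b ≤ ε → c * b ≤ vv μ m x)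
    (hi : ∀ x : ℤ, |(x:ℝ)| * b ≤ ε → c4 * b ≤ vv μ i x) :
    ∀ x : ℤ, |(x:ℝ)| * b ≤ ε → c * (c4 * ε) * b ≤ vv μ (m + i) x := by
  intro x hx
  set L : ℕ := ⌊ε / b⌋₊ with hL
  have hLb : (L:ℝ) * b ≤ ε := by
    rw [← le_div_iff₀ hb]; exact Nat.floor_le (by positivity)
  have hL1 : ε ≤ ((L:ℝ) + 1) * b := by
    rw [← div_le_iff₀ hb]; exact (Nat.lt_floor_add_one _).le
  have key : ∀ s : Finset ℤ, s.card = L + 1 →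
      (∀ y ∈ s, |(y:ℝ)| * b ≤ ε ∧ |((x - y : ℤ):ℝ)| * b ≤ ε) →
      c * (c4 * ε) * b ≤ vv μ (m + i) x := by
    intro s hs hy
    refine le_trans ?_ (H.vv_conv m i x s)
    have h1 : ∑ y ∈ s, (c * b) * (c4 * b) ≤ ∑ y ∈ s, vv μ m y * vv μ i (x - y) := by
      refine Finset.sum_le_sum fun y hys => ?_
      exact mul_le_mul (hm y (hy y hys).1) (hi _ (hy y hys).2) (by positivity) (H.vv_nonneg m y)
    refine le_trans ?_ h1
    rw [Finset.sum_const, hs, nsmul_eq_mul]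
    push_cast
    have := mul_le_mul_of_nonneg_left hL1 (by positivity : 0 ≤ c * c4 * b)
    nlinarith
  have bd : ∀ z : ℤ, (|z| ≤ L ∨ |z| ≤ |x|) → |(z:ℝ)| * b ≤ ε := by
    rintro z (hz | hz)
    · have : |(z:ℝ)| ≤ L := by exact_mod_cast hz
      exact le_trans (mul_le_mul_of_nonneg_right this hb.le) hLb
    · have : |(z:ℝ)| ≤ |(x:ℝ)| := by exact_mod_cast hz
      exact le_trans (mul_le_mul_of_nonneg_right this hb.le) hx
  rcases le_total 0 x with h0 | h0
  · refine key (Finset.Icc 0 (L:ℤ)) (by simp) fun y hy => ?_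
    rw [Finset.mem_Icc] at hy
    exact ⟨bd _ (by simp only [Int.abs_eq_natAbs]; omega),
      bd _ (by simp only [Int.abs_eq_natAbs]; omega)⟩
  · refine key (Finset.Icc (-(L:ℤ)) 0) (by simp; omega) fun y hy => ?_
    rw [Finset.mem_Icc] at hy
    exact ⟨bd _ (by simp only [Int.abs_eq_natAbs]; omega),
      bd _ (by simp only [Int.abs_eq_natAbs]; omega)⟩

lemma OffHyp.good_iter {μ : ℕ → ℝ} (H : OffHyp μ) {b ε c4 : ℝ} (hb : 0 < b)
    (hc4 : 0 ≤ c4) (hε : 0 < ε) {i0 : ℕ}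
    (h0 : ∀ x : ℤ, |(x:ℝ)| * b ≤ ε → c4 * b ≤ vv μ i0 x)
    (h1 : ∀ x : ℤ, |(x:ℝ)| * b ≤ ε → c4 * b ≤ vv μ (i0 + 1) x) (r : ℕ) :
    ∀ s, s ≤ r + 1 → ∀ x : ℤ, |(x:ℝ)| * b ≤ ε →
      c4 * (c4 * ε) ^ r * b ≤ vv μ ((r + 1) * i0 + s) x := by
  induction r with
  | zero =>
    intro s hs x hx
    rcases (by omega : s = 0 ∨ s = 1) with rfl | rfl
    · simpa using h0 x hx
    · simpa using h1 x hx
  | succ r ih =>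
    intro s hs x hx
    rcases Nat.eq_zero_or_pos s with rfl | hs0
    · have := H.good_step hb (by positivity) hc4 hε (ih 0 (by omega)) h0 x hx
      rw [show (r + 1 + 1) * i0 + 0 = (r + 1) * i0 + 0 + i0 by ring, pow_succ]
      linarith
    · have := H.good_step hb (by positivity) hc4 hε (ih (s - 1) (by omega)) h1 x hx
      obtain ⟨t, rfl⟩ : ∃ t, s = t + 1 := ⟨s - 1, by omega⟩
      rw [show (r + 1 + 1) * i0 + (t + 1) = (r + 1) * i0 + (t + 1 - 1) + (i0 + 1) by
        rw [Nat.add_sub_cancel]; ring, pow_succ]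
      linarith

lemma OffHyp.time_smooth {μ a : ℕ → ℝ} (H : OffHyp μ) (S : SeqA μ a) {C : ℝ} (hC : 0 < C)
    (hv3 : ∀ (n : ℕ), 1 ≤ n → ∀ (x : ℤ), |vv μ (n + 1) x - vv μ n x| ≤ C * (a n / n))
    {j : ℕ} (hj : 1 ≤ j) (d : ℕ) :
    |vv μ (j + d) 0 - vv μ j 0| ≤ d * (C * (a j / j)) := by
  induction d with
  | zero => simp
  | succ d ih =>
    have h1 := hv3 (j + d) (by omega) 0
    have h2 : a (j + d) ≤ a j := S.anti H hj (by omega)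
    have hp := S.pos (j + d) (by omega)
    have hj0 : (0:ℝ) < j := by positivity
    have h3 : a (j + d) / ((j + d : ℕ):ℝ) ≤ a j / j := by
      apply div_le_div₀ (by linarith) h2 hj0
      push_cast; have : (0:ℝ) ≤ d := by positivity
      linarith
    have h4 := mul_le_mul_of_nonneg_left h3 hC.le
    have h5 := abs_sub_le (vv μ (j + (d + 1)) 0) (vv μ (j + d) 0) (vv μ j 0)
    rw [← add_assoc] at h5 ⊢
    push_cast
    linarith

lemma OffHyp.lower {μ a : ℕ → ℝ} (H : OffHyp μ) (S : SeqA μ a) {C : ℝ} (hC : 0 < C)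
    (hv2 : ∀ (n : ℕ), 1 ≤ n → ∀ (x : ℤ), |vv μ n x - vv μ n 0| ≤ C * |(x:ℝ)| * a n ^ 2)
    (hv3 : ∀ (n : ℕ), 1 ≤ n → ∀ (x : ℤ), |vv μ (n + 1) x - vv μ n x| ≤ C * (a n / n))
    {δ c3 : ℝ} {K n1 : ℕ} (hδ : 0 < δ) (hδ1 : δ ≤ 1) (hc3 : 0 < c3) (hK : 1 ≤ K)
    (hgood : ∀ n : ℕ, n1 ≤ n → ∃ j : ℕ, 1 ≤ j ∧ δ * n ≤ j ∧ j ≤ K * n ∧ c3 * a n ≤ vv μ j 0) :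
    ∃ c5 : ℝ, 0 < c5 ∧ ∀ᶠ N : ℕ in atTop, c5 * a N ≤ vv μ N (-1) := by
  obtain ⟨Q, hQ⟩ := exists_nat_ge (4 * C / (c3 * δ))
  have hQ0 : (0:ℝ) < Q := lt_of_lt_of_le (by positivity) hQ
  have hQ1 : 1 ≤ Q := by exact_mod_cast hQ0
  have hq1 : 1 ≤ Q * K := Nat.mul_pos hQ1 hK
  obtain ⟨R, hR⟩ := exists_nat_ge (2 * ((Q * K : ℕ):ℝ) / δ)
  set c4 := c3 / 4 with hc4
  have hc4p : 0 < c4 := by positivity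
  set ε := min (c3 * δ ^ 2 / (4 * C)) (1 / c4) with hεd
  have hε : 0 < ε := lt_min (by positivity) (by positivity)
  have hε1 : C * ε ≤ c4 * δ ^ 2 := by
    have : ε ≤ c3 * δ ^ 2 / (4 * C) := min_le_left _ _
    rw [le_div_iff₀ (by positivity)] at this
    rw [hc4]; linarith
  have hε2 : c4 * ε ≤ 1 := by
    have : ε ≤ 1 / c4 := min_le_right _ _
    rw [le_div_iff₀ hc4p] at this
    linarith
  refine ⟨c4 * (c4 * ε) ^ R, by positivity, ?_⟩
  -- eventual conditions on n = N / q
  have ev : ∀ᶠ n : ℕ in atTop, n1 ≤ n ∧ 1 ≤ n ∧ a n < ε ∧ (Q:ℝ) / δ ≤ n := by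
    filter_upwards [eventually_ge_atTop n1, eventually_ge_atTop 1,
      (S.tendsto H).eventually_lt_const hε,
      tendsto_natCast_atTop_atTop.eventually_ge_atTop ((Q:ℝ) / δ)] with n h1 h2 h3 h4
    exact ⟨h1, h2, h3, h4⟩
  have hdiv : Tendsto (fun N : ℕ => N / (Q * K)) atTop atTop :=
    Nat.tendsto_div_const_atTop (by omega)
  filter_upwards [hdiv.eventually ev] with N hN
  obtain ⟨hn1, hn, han, hnQ⟩ := hN
  set q := Q * K with hq
  set n := N / q with hnd
  have hNn : q * n ≤ N := Nat.mul_div_le N q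
  have hNn2 : N < q * (n + 1) := by
    have := Nat.lt_mul_div_succ N (show 0 < q by omega)
    simpa [hnd] using this
  have hnN : n ≤ N := Nat.div_le_self _ _
  obtain ⟨j, hj1, hjn, hjK, hjv⟩ := hgood n hn1
  have hb := S.pos n hn
  have hjQ : (Q:ℝ) ≤ j := by
    rw [div_le_iff₀ hδ] at hnQ; linarith
  have hj0 : (0:ℝ) < j := by positivity
  have hajn : a j ≤ 1 / δ * a n := by
    apply S.scale H hj1 (by rw [le_div_iff₀ hδ]; linarith) hn
    rw [div_mul_eq_mul_div, le_div_iff₀ hδ]; linarith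
  have hajn' : δ * a j ≤ a n := by
    rw [div_mul_eq_mul_div, le_div_iff₀ hδ] at hajn; linarith
  have hap := S.pos j hj1
  set r := N / j with hr
  have hrQ : Q ≤ r := by
    rw [hr, Nat.le_div_iff_mul_le (by omega)]
    calc Q * j ≤ Q * (K * n) := Nat.mul_le_mul_left _ hjK
      _ = q * n := by rw [hq]; ring
      _ ≤ N := hNn
  have hr1 : 1 ≤ r := by omega
  have hrj : r * j ≤ N := Nat.div_mul_le_self N j
  have hrj2 : N < (r + 1) * j := by
    have := Nat.lt_mul_div_succ N (show 0 < j by omega)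
    rw [mul_comm]; simpa [hr] using this
  have hrR : r ≤ R := by
    have h1 : (r:ℝ) * j ≤ 2 * (q:ℝ) * n := by
      have : r * j ≤ 2 * q * n := by nlinarith
      exact_mod_cast this
    have h2 : (r:ℝ) ≤ 2 * (q:ℝ) / δ := by
      rw [le_div_iff₀ hδ]
      have hn0 : (0:ℝ) < n := by positivity
      have h3 : (r:ℝ) * (δ * n) ≤ 2 * q * n :=
        le_trans (mul_le_mul_of_nonneg_left hjn (by positivity)) h1
      have h4 : (r * δ) * n ≤ 2 * (q:ℝ) * n := by linarith
      exact le_of_mul_le_mul_right h4 hn0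
    exact_mod_cast h2.trans hR
  set i0 := N / r with hi0
  have hi0j : j ≤ i0 := by
    rw [hi0, Nat.le_div_iff_mul_le (by omega)]; linarith
  have hi0r : r * i0 ≤ N := Nat.mul_div_le N r
  -- goodness of times close to j
  have hP : ∀ d : ℕ, r * d ≤ j + r → ∀ x : ℤ, |(x:ℝ)| * a n ≤ ε → c4 * a n ≤ vv μ (j + d) x := by
    intro d hd x hx
    have h1 := H.time_smooth S hC hv3 hj1 d
    have h2 := hv2 (j + d) (by omega) x
    have haa : a (j + d) ≤ a j := S.anti H hj1 (by omega)
    have hai := S.pos (j + d) (by omega)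
    have h3 : (d:ℝ) * (C * (a j / j)) ≤ c3 / 2 * a n := by
      have hrr : (0:ℝ) < r := by positivity
      have hrQ' : (Q:ℝ) ≤ r := by exact_mod_cast hrQ
      have hd' : (r:ℝ) * d ≤ j + r := by exact_mod_cast hd
      have hd2 : (d:ℝ) * Q ≤ 2 * j := by
        -- d ≤ j / r + 1
        have e1 : (d:ℝ) ≤ j / r + 1 := by
          rw [← sub_le_iff_le_add, le_div_iff₀ hrr]; linarith
        have e2 : (j:ℝ) / r * Q ≤ j := by
          rw [div_mul_eq_mul_div, div_le_iff₀ hrr]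
          exact mul_le_mul_of_nonneg_left hrQ' hj0.le
        nlinarith
      have hQ2 : 4 * C ≤ Q * (c3 * δ) := by
        rw [div_le_iff₀ (by positivity)] at hQ; exact hQ
      have e3 : (d:ℝ) * (4 * C) ≤ 2 * j * (c3 * δ) := by
        calc (d:ℝ) * (4 * C) ≤ d * (Q * (c3 * δ)) :=
              mul_le_mul_of_nonneg_left hQ2 (by positivity)
          _ = (d * Q) * (c3 * δ) := by ring
          _ ≤ _ := mul_le_mul_of_nonneg_right hd2 (by positivity)
      have e4 : (d:ℝ) * C / j ≤ c3 * δ / 2 := by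
        rw [div_le_iff₀ hj0]; linarith
      calc (d:ℝ) * (C * (a j / j)) = (d:ℝ) * C / j * a j := by ring
        _ ≤ c3 * δ / 2 * a j := mul_le_mul_of_nonneg_right e4 hap.le
        _ = c3 / 2 * (δ * a j) := by ring
        _ ≤ _ := mul_le_mul_of_nonneg_left hajn' (by positivity)
    have h4 : C * |(x:ℝ)| * a (j + d) ^ 2 ≤ c4 * a n := by
      have e1 : δ * a (j + d) ≤ a n := le_trans (mul_le_mul_of_nonneg_left haa hδ.le) hajn'
      have e2 : (δ * a (j + d)) ^ 2 ≤ a n ^ 2 := by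
        apply pow_le_pow_left₀ (by positivity) e1
      have e3 : C * |(x:ℝ)| * (δ * a (j + d)) ^ 2 ≤ C * ε * a n := by
        calc C * |(x:ℝ)| * (δ * a (j + d)) ^ 2 ≤ C * |(x:ℝ)| * a n ^ 2 :=
              mul_le_mul_of_nonneg_left e2 (by positivity)
          _ = C * (|(x:ℝ)| * a n) * a n := by ring
          _ ≤ _ := by gcongr
      have e4 : C * ε * a n ≤ c4 * δ ^ 2 * a n := mul_le_mul_of_nonneg_right hε1 hb.le
      have e5 : δ ^ 2 * (C * |(x:ℝ)| * a (j + d) ^ 2) ≤ δ ^ 2 * (c4 * a n) := by nlinarith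
      exact le_of_mul_le_mul_left e5 (by positivity)
    rw [abs_le] at h1 h2
    rw [hc4] at h4 ⊢
    linarith
  have hd0 : r * (i0 - j) ≤ j := by
    rw [Nat.mul_sub];
    have : (r + 1) * j = r * j + j := by ring
    omega
  have hA := hP (i0 - j) (by omega)
  have hB := hP (i0 - j + 1) (by rw [Nat.mul_add]; omega)
  rw [show j + (i0 - j) = i0 by omega] at hA
  rw [show j + (i0 - j + 1) = i0 + 1 by omega] at hB
  obtain ⟨r', hr'⟩ : ∃ r', r = r' + 1 := ⟨r - 1, by omega⟩
  have hmod : N % r < r := Nat.mod_lt _ (by omega)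
  have hfin := H.good_iter hb hc4p.le hε hA hB r' (N % r) (by omega) (-1)
    (by simp; exact han.le)
  rw [← hr', hi0, Nat.div_add_mod] at hfin
  refine le_trans ?_ hfin
  have g1 : (c4 * ε) ^ R ≤ (c4 * ε) ^ r' := pow_le_pow_of_le_one (by positivity) hε2 (by omega)
  have g2 : a N ≤ a n := S.anti H hn hnN
  have hN0 := S.pos N (by omega)
  gcongr

lemma tp_eq_vv (μ : ℕ → ℝ) (n : ℕ) (hn : 1 ≤ n) : (n:ℝ) * tp μ n = vv μ n (-1) := by
  obtain ⟨m, rfl⟩ : ∃ m, n = m + 1 := ⟨n - 1, by omega⟩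
  have h := tp_eq μ m
  push_cast
  rw [h]
  unfold vv
  rw [if_pos (by push_cast; omega)]
  congr 1
  push_cast; omega

lemma OffHyp.reg {μ a : ℕ → ℝ} (H : OffHyp μ) (S : SeqA μ a) {C c5 : ℝ} (hC : 0 < C)
    (hc5 : 0 < c5)
    (hv1 : ∀ (n : ℕ), 1 ≤ n → ∀ (x : ℤ), vv μ n x ≤ C * a n)
    (hv3 : ∀ (n : ℕ), 1 ≤ n → ∀ (x : ℤ), |vv μ (n + 1) x - vv μ n x| ≤ C * (a n / n))
    (hlow : ∀ᶠ N : ℕ in atTop, c5 * a N ≤ vv μ N (-1)) :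
    (∀ᶠ n : ℕ in atTop, 0 < tp μ n) ∧
    Tendsto (fun n => tp μ (n + 1) / tp μ n) atTop (nhds 1) ∧
    (∀ᶠ n : ℕ in atTop, ∀ j, j ≤ n → n ≤ 2 * j → tp μ j ≤ (4 * C / c5) * tp μ n) := by
  have hpos : ∀ᶠ n : ℕ in atTop, 0 < tp μ n := by
    filter_upwards [hlow, eventually_ge_atTop 1] with n hn h1
    rw [← tp_eq_vv μ n h1] at hn
    have := S.pos n h1
    have h2 : 0 < (n:ℝ) * tp μ n := lt_of_lt_of_le (by positivity) hn
    exact pos_of_mul_pos_right h2 (by positivity)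
  refine ⟨hpos, ?_, ?_⟩
  · have hz : Tendsto (fun n : ℕ => (C / c5) * (1 / (n:ℝ)) + 1 / ((n:ℝ) + 1)) atTop (nhds 0) := by
      have e1 := (tendsto_one_div_atTop_nhds_zero_nat (𝕜 := ℝ)).const_mul (C / c5)
      have e2 := tendsto_one_div_add_atTop_nhds_zero_nat (𝕜 := ℝ)
      simpa using e1.add e2
    have hz2 : Tendsto (fun n : ℕ => tp μ (n + 1) / tp μ n - 1) atTop (nhds 0) := by
      refine squeeze_zero_norm' ?_ hz
      filter_upwards [hlow, hpos, eventually_ge_atTop 1] with n hl hp h1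
      have hn0 : (0:ℝ) < n := by positivity
      have hv := hv3 n h1 (-1)
      rw [← tp_eq_vv μ n h1, ← tp_eq_vv μ (n + 1) (by omega)] at hv
      rw [← tp_eq_vv μ n h1] at hl
      push_cast at hv
      have hx : C * (a n / n) ≤ C / c5 * tp μ n := by
        have : a n / n ≤ tp μ n / c5 := by
          rw [div_le_div_iff₀ hn0 hc5]; linarith
        calc C * (a n / n) ≤ C * (tp μ n / c5) := mul_le_mul_of_nonneg_left this hC.le
          _ = _ := by ring
      have hy := hv.trans hx
      have e : tp μ (n + 1) / tp μ n - 1 =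
          ((((n:ℝ) + 1) * tp μ (n + 1) - n * tp μ n) / tp μ n - 1) / ((n:ℝ) + 1) := by
        field_simp; ring
      have f1 : |(((n:ℝ) + 1) * tp μ (n + 1) - n * tp μ n) / tp μ n| ≤ C / c5 := by
        rw [abs_div, abs_of_pos hp, div_le_iff₀ hp]; exact hy
      rw [Real.norm_eq_abs, e, abs_div, abs_of_pos (by positivity : (0:ℝ) < (n:ℝ) + 1)]
      have f2 : |(((n:ℝ) + 1) * tp μ (n + 1) - n * tp μ n) / tp μ n - 1| ≤ C / c5 + 1 := by
        refine (abs_sub _ _).trans ?_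
        rw [abs_one]; linarith
      calc _ ≤ (C / c5 + 1) / ((n:ℝ) + 1) := by gcongr
        _ = C / c5 * (1 / ((n:ℝ) + 1)) + 1 / ((n:ℝ) + 1) := by ring
        _ ≤ _ := by
          gcongr
          linarith
    simpa using hz2.add_const 1
  · filter_upwards [hlow, hpos, eventually_ge_atTop 1] with n hl hp h1 j hjn hnj
    have hj1 : 1 ≤ j := by omega
    have hj0 : (0:ℝ) < j := by positivity
    have hnj' : (n:ℝ) ≤ 2 * j := by exact_mod_cast hnj
    have g1 := hv1 j hj1 (-1)
    have g2 := S.scale H hj1 (by norm_num : (1:ℝ) ≤ 2) h1 hnj'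
    rw [← tp_eq_vv μ j hj1] at g1
    rw [← tp_eq_vv μ n h1] at hl
    have g3 : a n ≤ 2 * j * tp μ n / c5 := by
      rw [le_div_iff₀ hc5]
      have := mul_le_mul_of_nonneg_right hnj' hp.le
      linarith
    have g4 : (j:ℝ) * tp μ j ≤ j * (4 * C / c5 * tp μ n) := by
      calc (j:ℝ) * tp μ j ≤ C * a j := g1
        _ ≤ C * (2 * a n) := mul_le_mul_of_nonneg_left g2 hC.le
        _ ≤ C * (2 * (2 * j * tp μ n / c5)) := by gcongr
        _ = _ := by ring
    exact le_of_mul_le_mul_left g4 hj0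

/-- Let `μ` be a critical aperiodic probability measure on `ℤ₊` in the
domain of attraction of a stable law of index `α ∈ (1,2]`, fix `k ≥ 1`, and consider `k`
independent `BGW^μ` trees conditioned on total size `n`; let `M_n^{μ,k}` be the size of the
largest one. Then for every fixed `m ≥ 0`, `ℙ(n - M_n^{μ,k} = m)` converges as `n → ∞` to the
probability that the total size of `k-1` independent unconditioned `BGW^μ` trees equals `m`. -/
theorem largest_tree_in_conditioned_forest (μ : ℕ → ℝ) (α : ℝ)
    (hμnn : ∀ j, 0 ≤ μ j) (hμsum : HasSum μ 1)
    (hμpos : 0 < μ 0) (hμ01 : μ 0 + μ 1 < 1)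
    (hcrit : HasSum (fun j : ℕ => (j : ℝ) * μ j) 1)
    (haper : ∀ d : ℕ, (∀ i : ℕ, 0 < i → 0 < μ i → d ∣ i) → d = 1)
    (hα1 : 1 < α) (hα2 : α ≤ 2) (hdom : DomAttr μ α)
    (k : ℕ) (hk : 1 ≤ k) (m : ℕ) :
    Tendsto (fun n : ℕ =>
        (∑ᶠ F ∈ {F : Fin k → PlaneTree | (∑ i, (F i).verts.card) = n ∧
            n - (Finset.univ.sup fun i => (F i).verts.card) = m}, ∏ i, bgwW μ (F i)) /
        (∑ᶠ F ∈ {F : Fin k → PlaneTree | (∑ i, (F i).verts.card) = n}, ∏ i, bgwW μ (F i)))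
      atTop
      (nhds (∑ᶠ G ∈ {G : Fin (k - 1) → PlaneTree | (∑ i, (G i).verts.card) = m},
        ∏ i, bgwW μ (G i))) := by
  have H : OffHyp μ := ⟨hμnn, hμsum, hμpos, hcrit, haper⟩
  obtain ⟨c, hc, hQ⟩ := H.Hcond hα1 hdom
  obtain ⟨a, ha⟩ := H.exists_a
  have S : SeqA μ a := ⟨fun n hn => (ha n hn).1, fun n hn => (ha n hn).2⟩
  obtain ⟨β, C', hβ0, hβ1, hC', hpow⟩ := S.power H hc hQ
  obtain ⟨-, c2, hc2, hψ⟩ := H.psi_bound hc hQ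
  obtain ⟨C, hC, hv1, hv2, hv3⟩ := H.vv_bounds S hc2 hψ
  obtain ⟨δ, c3, K, n1, hδ, hδ1, hc3, hK, hgood⟩ := H.exists_good S hC hv1 hβ0 hβ1 hC' hpow
  obtain ⟨c5, hc5, hlow⟩ := H.lower S hC hv2 hv3 hδ hδ1 hc3 hK hgood
  obtain ⟨r1, r2, r3⟩ := H.reg S hC hc5 hv1 hv3 hlow
  exact final_of_reg μ (tp_hasSum μ hμnn hμsum hμ01 hcrit) _ r1 r2 r3 k hk m

end
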